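/- arXiv:2604.12363 — 8 statements merged into one kernel-verified Lean document; each statement's English description precedes it below -/
import Mathlib

section
/- Let G be a finite simple graph admitting a vertex cover of size at most k. If G admits a proper weight function w : E(G) → {0,1}, then G admits a proper weight function ŵ : E(G) → {0,1} such that color_ŵ(v) ≤ 8k² + 8k for every vertex v of G. -/
variable {V : Type*}

/-- The color of a vertex `v` induced by a `{0,1}`-edge-weighting `w`:
the sum of the weights of the edges of `G` incident to `v`. -/
noncomputable def vcColor [Finite V] (G : SimpleGraph V) (w : Sym2 V → Fin 2) (v : V) : ℕ :=
  ∑ e ∈ (G.incidenceSet v).toFinite.toFinset, (w e : ℕ)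

/-- A weight function is proper if adjacent vertices get distinct colors. -/
def vcProper [Finite V] (G : SimpleGraph V) (w : Sym2 V → Fin 2) : Prop :=
  ∀ u v : V, G.Adj u v → vcColor G w u ≠ vcColor G w v

/-- `S` is a vertex cover of `G`. -/
def IsVertexCover (G : SimpleGraph V) (S : Set V) : Prop :=
  ∀ ⦃u v : V⦄, G.Adj u v → u ∈ S ∨ v ∈ S

open Classical in
/-- The neighbours of `v` joined to it by an edge of weight `1`. -/
noncomputable def oneNeighbors [Fintype V] (G : SimpleGraph V) (w : Sym2 V → Fin 2) (v : V) :
    Finset V :=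
  Finset.univ.filter fun u => G.Adj v u ∧ w s(v, u) = 1

open Classical in
/-- The weighting obtained from `w` by giving weight `b` to all edges joining `a` to `X`. -/
noncomputable def setStar (w : Sym2 V → Fin 2) (a : V) (X : Finset V) (b : Fin 2) :
    Sym2 V → Fin 2 :=
  fun e => if ∃ x ∈ X, e = s(a, x) then b else w e

theorem mem_oneNeighbors [Fintype V] {G : SimpleGraph V} {w : Sym2 V → Fin 2} {u v : V} :
    u ∈ oneNeighbors G w v ↔ G.Adj v u ∧ w s(v, u) = 1 := by
  simp [oneNeighbors]

theorem vcColor_eq_card_oneNeighbors [Fintype V] (G : SimpleGraph V) (w : Sym2 V → Fin 2)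
    (v : V) : vcColor G w v = (oneNeighbors G w v).card := by
  classical
  have himage : (G.incidenceSet v).toFinite.toFinset
      = (Finset.univ.filter (G.Adj v)).image (fun u => s(v, u)) := by
    ext e
    induction e using Sym2.ind with
    | _ x y =>
      simp only [Set.Finite.mem_toFinset, Finset.mem_image, Finset.mem_filter, Finset.mem_univ,
        true_and, SimpleGraph.mk'_mem_incidenceSet_iff]
      constructor
      · rintro ⟨h, rfl | rfl⟩
        · exact ⟨y, h, rfl⟩
        · exact ⟨x, h.symm, Sym2.eq_swap⟩
      · rintro ⟨u, h, hu⟩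
        rcases Sym2.eq_iff.1 hu with ⟨rfl, rfl⟩ | ⟨rfl, rfl⟩
        · exact ⟨h, Or.inl rfl⟩
        · exact ⟨h.symm, Or.inr rfl⟩
  have hval : ∀ b : Fin 2, (b : ℕ) = if b = 1 then 1 else 0 := by decide
  rw [vcColor, himage, Finset.sum_image (fun x _ y _ h => Sym2.congr_right.1 h), oneNeighbors,
    ← Finset.filter_filter, Finset.card_filter]
  exact Finset.sum_congr rfl fun u _ => hval _

theorem vcColor_setStar_zero_add [Fintype V] [DecidableEq V] {G : SimpleGraph V}
    {w : Sym2 V → Fin 2} {a : V} {X : Finset V} (hX : X ⊆ oneNeighbors G w a) (v : V) :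
    vcColor G (setStar w a X 0) v + (if v = a then X.card else if v ∈ X then 1 else 0)
      = vcColor G w v := by
  simp only [vcColor_eq_card_oneNeighbors]
  have haX : a ∉ X := fun h => (mem_oneNeighbors.1 (hX h)).1.ne rfl
  split_ifs with hva hvX
  · subst hva
    have : oneNeighbors G (setStar w v X 0) v = oneNeighbors G w v \ X := by
      ext u
      simp only [mem_oneNeighbors, Finset.mem_sdiff, setStar, Sym2.congr_right]
      by_cases hu : u ∈ X <;> simp [hu]
    rw [this, Finset.card_sdiff_add_card_eq_card hX]
  · have : oneNeighbors G (setStar w a X 0) v = (oneNeighbors G w v).erase a := by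
      ext u
      simp only [mem_oneNeighbors, Finset.mem_erase, setStar]
      by_cases hu : u = a
      · subst hu
        have : ∃ x ∈ X, s(v, u) = s(u, x) := ⟨v, hvX, Sym2.eq_swap⟩
        rw [if_pos this]
        simp
      · have : ¬ ∃ x ∈ X, s(v, u) = s(a, x) := by
          rintro ⟨x, -, h⟩
          rcases Sym2.eq_iff.1 h with ⟨h, -⟩ | ⟨-, h⟩
          exacts [hva h, hu h]
        rw [if_neg this]
        simp [hu]
    rw [this]
    refine Finset.card_erase_add_one (mem_oneNeighbors.2 ?_)
    have h := mem_oneNeighbors.1 (hX hvX)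
    exact ⟨h.1.symm, by rw [Sym2.eq_swap]; exact h.2⟩
  · have : oneNeighbors G (setStar w a X 0) v = oneNeighbors G w v := by
      ext u
      have : ¬ ∃ x ∈ X, s(v, u) = s(a, x) := by
        rintro ⟨x, hx, h⟩
        rcases Sym2.eq_iff.1 h with ⟨h, -⟩ | ⟨h, -⟩
        exacts [hva h, hvX (h ▸ hx)]
      rw [mem_oneNeighbors, setStar, if_neg this, ← mem_oneNeighbors]
    rw [this, add_zero]

theorem vcColor_setStar_one [Fintype V] [DecidableEq V] {G : SimpleGraph V}
    {w : Sym2 V → Fin 2} {a : V} {X : Finset V}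
    (hX : ∀ x ∈ X, G.Adj a x ∧ w s(a, x) = 0) (v : V) :
    vcColor G (setStar w a X 1) v
      = vcColor G w v + (if v = a then X.card else if v ∈ X then 1 else 0) := by
  have hsub : X ⊆ oneNeighbors G (setStar w a X 1) a := fun x hx =>
    mem_oneNeighbors.2 ⟨(hX x hx).1, if_pos ⟨x, hx, rfl⟩⟩
  have hback : setStar (setStar w a X 1) a X 0 = w := by
    funext e
    by_cases h : ∃ x ∈ X, e = s(a, x)
    · obtain ⟨x, hx, rfl⟩ := h
      rw [setStar, if_pos ⟨x, hx, rfl⟩, (hX x hx).2]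
    · simp only [setStar, if_neg h]
  rw [← vcColor_setStar_zero_add hsub v, hback]

theorem IsVertexCover.proper_of_forall {G : SimpleGraph V} [Finite V] {S : Set V}
    (hvc : IsVertexCover G S) {w : Sym2 V → Fin 2}
    (h : ∀ u ∈ S, ∀ v, G.Adj u v → vcColor G w u ≠ vcColor G w v) : vcProper G w := by
  intro u v huv
  rcases hvc huv with hu | hv
  · exact h u hu v huv
  · exact (h v hv u huv.symm).symm

theorem IsVertexCover.vcColor_le_of_notMem [Fintype V] {G : SimpleGraph V} {S : Finset V}
    (hvc : IsVertexCover G (S : Set V)) (w : Sym2 V → Fin 2) {v : V} (hv : v ∉ S) :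
    vcColor G w v ≤ S.card := by
  rw [vcColor_eq_card_oneNeighbors]
  refine Finset.card_le_card fun u hu => ?_
  rcases hvc (mem_oneNeighbors.1 hu).1 with h | h
  exacts [absurd (Finset.mem_coe.1 h) hv, h]

/-- If a vertex `a` of large color has many weight-one neighbours outside the cover all of whose
neighbours have large color, then its color can be lowered, keeping it large. -/
theorem exists_proper_lowering [Fintype V] [DecidableEq V] {G : SimpleGraph V} {S : Finset V}
    {k : ℕ} (hvc : IsVertexCover G (S : Set V)) (hS : S.card ≤ k) {w : Sym2 V → Fin 2}
    (hw : vcProper G w) {a : V} (ha : 2 * k < vcColor G w a) (haS : a ∈ S) {Y : Finset V}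
    (hY : Y ⊆ oneNeighbors G w a) (hYS : ∀ y ∈ Y, y ∉ S)
    (hYbig : ∀ y ∈ Y, ∀ t, G.Adj y t → k < vcColor G w t) (hcard : k ≤ Y.card) :
    ∃ w' : Sym2 V → Fin 2, vcProper G w' ∧ (∀ v, vcColor G w' v ≤ vcColor G w v) ∧
      vcColor G w' a < vcColor G w a ∧ ∀ v, k < vcColor G w v → k < vcColor G w' v := by
  obtain ⟨q, hq, hqbad⟩ : ∃ q ∈ Finset.Icc 1 k,
      q ∉ (S.erase a).image fun s => vcColor G w a - vcColor G w s := by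
    apply Finset.exists_mem_notMem_of_card_lt_card
    have h1 := Finset.card_image_le (s := S.erase a)
      (f := fun s => vcColor G w a - vcColor G w s)
    have h2 := Finset.card_erase_lt_of_mem haS
    rw [Nat.card_Icc]
    omega
  rw [Finset.mem_Icc] at hq
  obtain ⟨X, hXY, hXq⟩ := Finset.exists_subset_card_eq (hq.2.trans hcard)
  have hc := vcColor_setStar_zero_add (hXY.trans hY)
  set w' := setStar w a X 0
  have hca : vcColor G w' a + q = vcColor G w a := by simpa [hXq] using hc a
  have hle : ∀ v, vcColor G w' v ≤ vcColor G w v := fun v => (hc v).le.trans' (by omega)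
  have hother : ∀ v, v ≠ a → v ∉ X → vcColor G w' v = vcColor G w v := fun v h1 h2 => by
    simpa [h1, h2] using hc v
  have hout : ∀ v, v ∉ S → vcColor G w' v ≤ k := fun v hv =>
    (hvc.vcColor_le_of_notMem w' hv).trans hS
  have hin : ∀ v ∈ S, v ≠ a → vcColor G w' v = vcColor G w v := fun v hv hva =>
    hother v hva fun h => hYS v (hXY h) hv
  have hne : ∀ v, v ≠ a → vcColor G w' a ≠ vcColor G w' v := by
    intro v hva
    by_cases hv : v ∈ S
    · intro h
      rw [hin v hv hva] at h
      exact hqbad (Finset.mem_image.2 ⟨v, Finset.mem_erase.2 ⟨hva, hv⟩, by omega⟩)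
    · have := hout v hv
      omega
  refine ⟨w', hvc.proper_of_forall ?_, hle, by omega, ?_⟩
  · intro u hu v huv
    by_cases hua : u = a
    · subst hua
      exact hne v huv.ne'
    by_cases hva : v = a
    · subst hva
      exact (hne u hua).symm
    rw [hin u hu hua]
    by_cases hvX : v ∈ X
    · have h1 := hYbig v (hXY hvX) u huv.symm
      have h2 := hout v (hYS v (hXY hvX))
      omega
    · rw [hother v hva hvX]
      exact hw u v huv
  · intro v hv
    by_cases hva : v = a
    · subst hva
      omega
    · by_cases hvS : v ∈ S
      · rwa [hin v hvS hva]
      · have := (hvc.vcColor_le_of_notMem w hvS).trans hS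
        omega

/-- If a vertex `a` of large color and a vertex `t` of small color have many common neighbours
outside the cover, joined to `a` with weight `1` and to `t` with weight `0`, then exchanging some
of these weights makes the color of `t` large. -/
theorem exists_proper_exchange [Fintype V] [DecidableEq V] {G : SimpleGraph V} {S : Finset V}
    {k : ℕ} (hvc : IsVertexCover G (S : Set V)) (hS : S.card ≤ k) {w : Sym2 V → Fin 2}
    (hw : vcProper G w) {a t : V} (ha : 4 * k + 2 < vcColor G w a)
    (ht : vcColor G w t ≤ k) {Y : Finset V}
    (hY : Y ⊆ oneNeighbors G w a) (hYt : ∀ y ∈ Y, G.Adj t y ∧ w s(t, y) = 0)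
    (hcard : 3 * k + 2 ≤ Y.card) :
    ∃ w' : Sym2 V → Fin 2, vcProper G w' ∧ k < vcColor G w' t ∧
      ∀ v, k < vcColor G w v → k < vcColor G w' v := by
  have hta : t ≠ a := by
    rintro rfl
    omega
  obtain ⟨q, hq, hqbad⟩ : ∃ q ∈ Finset.Icc (k + 1) (3 * k + 2),
      q ∉ insert ((vcColor G w a - vcColor G w t) / 2)
        (S.image (fun s => vcColor G w s - vcColor G w t) ∪
          S.image (fun s => vcColor G w a - vcColor G w s)) := by
    apply Finset.exists_mem_notMem_of_card_lt_card
    have h1 := Finset.card_image_le (s := S) (f := fun s => vcColor G w s - vcColor G w t)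
    have h2 := Finset.card_image_le (s := S) (f := fun s => vcColor G w a - vcColor G w s)
    have h3 := Finset.card_union_le
      (S.image (fun s => vcColor G w s - vcColor G w t))
      (S.image (fun s => vcColor G w a - vcColor G w s))
    have h4 := Finset.card_insert_le ((vcColor G w a - vcColor G w t) / 2)
      (S.image (fun s => vcColor G w s - vcColor G w t) ∪
        S.image (fun s => vcColor G w a - vcColor G w s))
    rw [Nat.card_Icc]
    omega
  rw [Finset.mem_Icc] at hq
  simp only [Finset.mem_insert, Finset.mem_union, Finset.mem_image, not_or, not_exists,
    not_and] at hqbad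
  obtain ⟨hq1, hq2, hq3⟩ := hqbad
  obtain ⟨X, hXY, hXq⟩ := Finset.exists_subset_card_eq (hq.2.trans hcard)
  have haX : a ∉ X := fun h => (mem_oneNeighbors.1 (hY (hXY h))).1.ne rfl
  have htX : t ∉ X := fun h => (hYt t (hXY h)).1.ne rfl
  have hdown := vcColor_setStar_zero_add (hXY.trans hY)
  have hup := vcColor_setStar_one (G := G) (w := setStar w a X 0) (a := t) (X := X) (by
    intro x hx
    refine ⟨(hYt x (hXY hx)).1, ?_⟩
    unfold setStar
    split_ifs
    · rfl
    · exact (hYt x (hXY hx)).2)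
  set w' := setStar (setStar w a X 0) t X 1
  have hca : vcColor G w' a + q = vcColor G w a := by
    have h1 := hdown a
    have h2 := hup a
    simp only [if_true, hta.symm, haX, if_false] at h1 h2
    omega
  have hct : vcColor G w' t = vcColor G w t + q := by
    have h1 := hdown t
    have h2 := hup t
    simp only [if_true, hta, htX, if_false] at h1 h2
    omega
  have hother : ∀ v, v ≠ a → v ≠ t → vcColor G w' v = vcColor G w v := by
    intro v h1 h2
    have h3 := hdown v
    have h4 := hup v
    simp only [h1, h2, if_false] at h3 h4
    omega
  have hout : ∀ v, v ∉ S → vcColor G w v ≤ k := fun v hv =>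
    (hvc.vcColor_le_of_notMem w hv).trans hS
  have hat : vcColor G w' a ≠ vcColor G w' t := by omega
  have hne : ∀ v, v ≠ a → v ≠ t →
      vcColor G w' a ≠ vcColor G w' v ∧ vcColor G w' t ≠ vcColor G w' v := by
    intro v hva hvt
    rw [hother v hva hvt]
    by_cases hv : v ∈ S
    · have h2 := hq2 v hv
      have h3 := hq3 v hv
      omega
    · have := hout v hv
      omega
  refine ⟨w', fun u v huv => ?_, by omega, ?_⟩
  · by_cases hua : u = a
    · subst hua
      by_cases hvt : v = t
      · rwa [hvt]
      · exact (hne v huv.ne' hvt).1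
    by_cases hut : u = t
    · subst hut
      by_cases hva : v = a
      · rw [hva]
        exact hat.symm
      · exact (hne v hva huv.ne').2
    by_cases hva : v = a
    · rw [hva]
      exact (hne u hua hut).1.symm
    by_cases hvt : v = t
    · rw [hvt]
      exact (hne u hua hut).2.symm
    rw [hother u hua hut, hother v hva hvt]
    exact hw u v huv
  · intro v hv
    by_cases hva : v = a
    · subst hva
      omega
    by_cases hvt : v = t
    · subst hvt
      omega
    rwa [hother v hva hvt]

/-- A vertex of very large color admits a lowering or an exchange. -/
theorem exists_proper_improvement [Fintype V] {G : SimpleGraph V} {S : Finset V}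
    {k : ℕ} (hvc : IsVertexCover G (S : Set V)) (hS : S.card ≤ k) {w : Sym2 V → Fin 2}
    (hw : vcProper G w) {a : V} (ha : 8 * k ^ 2 + 8 * k < vcColor G w a) :
    ∃ w' : Sym2 V → Fin 2, vcProper G w' ∧ (∀ v, k < vcColor G w v → k < vcColor G w' v) ∧
      ((∃ t, vcColor G w t ≤ k ∧ k < vcColor G w' t) ∨
        ((∀ v, vcColor G w' v ≤ vcColor G w v) ∧ vcColor G w' a < vcColor G w a)) := by
  classical
  have haS : a ∈ S := by
    by_contra h
    have := hvc.vcColor_le_of_notMem w h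
    nlinarith
  have hk : 1 ≤ k := (Finset.card_pos.2 ⟨a, haS⟩).trans_le hS
  let N := oneNeighbors G w a \ S
  let P : V → Prop := fun v => ∃ t, G.Adj v t ∧ vcColor G w t ≤ k
  have hNsub : N ⊆ oneNeighbors G w a := Finset.sdiff_subset
  have hNS : ∀ y ∈ N, y ∉ S := fun y hy => (Finset.mem_sdiff.1 hy).2
  have hN : vcColor G w a ≤ N.card + S.card := by
    rw [vcColor_eq_card_oneNeighbors]
    exact Finset.card_le_card_sdiff_add_card
  have hsplit := Finset.card_filter_add_card_filter_not (s := N) P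
  by_cases hfree : k ≤ (N.filter fun v => ¬ P v).card
  · obtain ⟨w', h1, h2, h3, h4⟩ := exists_proper_lowering hvc hS hw (by nlinarith) haS
      ((Finset.filter_subset _ _).trans hNsub)
      (fun y hy => hNS y (Finset.mem_filter.1 hy).1)
      (fun y hy t hyt => by
        obtain ⟨-, hyP⟩ := Finset.mem_filter.1 hy
        exact not_le.1 fun h => hyP ⟨t, hyt, h⟩) hfree
    exact ⟨w', h1, h4, Or.inr ⟨h2, h3⟩⟩
  · let Y : V → Finset V := fun t => N.filter (G.Adj t)
    let L := S.filter fun t => vcColor G w t ≤ k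
    have hcover : N.filter P ⊆ L.biUnion Y := by
      intro v hv
      obtain ⟨hvN, t, hvt, ht⟩ := Finset.mem_filter.1 hv
      have htS : t ∈ S := (hvc hvt).resolve_left (hNS v hvN)
      exact Finset.mem_biUnion.2
        ⟨t, Finset.mem_filter.2 ⟨htS, ht⟩, Finset.mem_filter.2 ⟨hvN, hvt.symm⟩⟩
    obtain ⟨t, htL, ht⟩ : ∃ t ∈ L, 8 * k < (Y t).card := by
      by_contra! h
      have h1 := (Finset.card_le_card hcover).trans (Finset.card_biUnion_le_card_mul _ _ _ h)
      have h2 : L.card ≤ k := (Finset.card_filter_le _ _).trans hS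
      have h3 : L.card * (8 * k) ≤ k * (8 * k) := Nat.mul_le_mul_right _ h2
      nlinarith
    have htk : vcColor G w t ≤ k := (Finset.mem_filter.1 htL).2
    have hdiff : (Y t).card ≤ (Y t \ oneNeighbors G w t).card + vcColor G w t := by
      rw [vcColor_eq_card_oneNeighbors]
      exact Finset.card_le_card_sdiff_add_card
    have hmem : ∀ y ∈ Y t \ oneNeighbors G w t, y ∈ N ∧ G.Adj t y ∧ w s(t, y) = 0 := by
      intro y hy
      obtain ⟨hy1, hy2⟩ := Finset.mem_sdiff.1 hy
      obtain ⟨hyN, hty⟩ := Finset.mem_filter.1 hy1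
      have hbit : ∀ b : Fin 2, b ≠ 1 → b = 0 := by decide
      exact ⟨hyN, hty, hbit _ fun h => hy2 (mem_oneNeighbors.2 ⟨hty, h⟩)⟩
    obtain ⟨w', h1, h2, h3⟩ := exists_proper_exchange hvc hS hw (a := a) (t := t)
      (by nlinarith) htk (fun y hy => hNsub (hmem y hy).1)
      (fun y hy => (hmem y hy).2) (by omega)
    exact ⟨w', h1, h3, Or.inl ⟨t, htk, h2⟩⟩

/-- If a finite simple graph with a vertex cover of size at most `k`
admits a proper `{0,1}`-edge-weighting, then it admits one in which every vertex
has color at most `8k² + 8k`. -/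
theorem stmt_0 [Finite V] (G : SimpleGraph V) (k : ℕ) (S : Set V)
    (hvc : IsVertexCover G S) (hS : S.ncard ≤ k)
    (hex : ∃ w : Sym2 V → Fin 2, vcProper G w) :
    ∃ w2 : Sym2 V → Fin 2, vcProper G w2 ∧
      ∀ v : V, vcColor G w2 v ≤ 8 * k ^ 2 + 8 * k := by
  classical
  have := Fintype.ofFinite V
  have hvc' : IsVertexCover G (S.toFinset : Set V) := by simpa using hvc
  rw [Set.ncard_eq_toFinset_card'] at hS
  let big : (Sym2 V → Fin 2) → Finset V := fun w => Finset.univ.filter fun v => k < vcColor G w v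
  obtain ⟨w₀, hw₀, hmax⟩ := Set.exists_max_image {w | vcProper G w} (fun w => (big w).card)
    (Set.toFinite _) hex
  obtain ⟨w, ⟨hw, hbig⟩, hmin⟩ := Set.exists_min_image
    {w | vcProper G w ∧ (big w₀).card ≤ (big w).card} (fun w => ∑ v, vcColor G w v)
    (Set.toFinite _) ⟨w₀, hw₀, le_rfl⟩
  refine ⟨w, hw, fun a => ?_⟩
  by_contra! ha
  obtain ⟨w', hw', hmono, h⟩ := exists_proper_improvement hvc' hS hw ha
  have hsub : big w ⊆ big w' := fun v hv =>
    Finset.mem_filter.2 ⟨Finset.mem_univ v, hmono v (Finset.mem_filter.1 hv).2⟩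
  rcases h with ⟨t, ht, ht'⟩ | ⟨hle, hlt⟩
  · have hss : big w ⊂ big w' := (Finset.ssubset_iff_of_subset hsub).2
      ⟨t, Finset.mem_filter.2 ⟨Finset.mem_univ t, ht'⟩,
        fun h => absurd (Finset.mem_filter.1 h).2 (not_lt.2 ht)⟩
    exact absurd (hmax w' hw') (not_le.2 (hbig.trans_lt (Finset.card_lt_card hss)))
  · have hsum : ∑ v, vcColor G w' v < ∑ v, vcColor G w v :=
      Finset.sum_lt_sum (fun v _ => hle v) ⟨a, Finset.mem_univ a, hlt⟩
    exact absurd (hmin w' ⟨hw', hbig.trans (Finset.card_le_card hsub)⟩) (not_le.2 hsum)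
end

section
/- Let G be a finite simple graph admitting a vertex cover of size at most k. If G admits a proper weight function w : E(G) → {0,1}, then G admits a proper weight function ŵ such that the number of edges e with ŵ(e) = 1 is at most k(8k² + 8k). -/
variable {V : Type*}

open Classical in
/-- The color of `v` is the number of neighbors of `v` joined to it by an edge of weight `1`. -/
lemma vcColor_eq_card [Fintype V] (G : SimpleGraph V) (w : Sym2 V → Fin 2) (v : V) :
    vcColor G w v = (Finset.univ.filter fun u => G.Adj v u ∧ w s(v, u) = 1).card := by
  have himage : (G.incidenceSet v).toFinite.toFinset =
      (Finset.univ.filter fun u => G.Adj v u).image fun u => s(v, u) := by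
    ext e
    induction e with
    | h a b =>
      simp only [Set.Finite.mem_toFinset, SimpleGraph.mk'_mem_incidenceSet_iff, Finset.mem_image,
        Finset.mem_filter, Finset.mem_univ, true_and, Sym2.eq_iff]
      constructor
      · rintro ⟨h, rfl | rfl⟩
        · exact ⟨b, h, Or.inl ⟨rfl, rfl⟩⟩
        · exact ⟨a, h.symm, Or.inr ⟨rfl, rfl⟩⟩
      · rintro ⟨u, h, ⟨rfl, rfl⟩ | ⟨rfl, rfl⟩⟩
        · exact ⟨h, Or.inl rfl⟩
        · exact ⟨h.symm, Or.inr rfl⟩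
  have hval : ∀ x : Fin 2, (x : ℕ) = if x = 1 then 1 else 0 := by decide
  rw [vcColor, himage, Finset.sum_image fun a _ b _ h => Sym2.congr_right.mp h,
    ← Finset.filter_filter, Finset.card_filter]
  exact Finset.sum_congr rfl fun u _ => hval _

/-- Distinct values avoiding a finite set can be chosen in intervals of sufficient length. -/
lemma exists_injOn_mem_Icc_notMem {α : Type*} (H : Finset α) (c : α → ℕ) (F : Finset ℕ) (n : ℕ)
    (hcard : F.card + H.card ≤ n + 1) :
    ∃ f : α → ℕ, Set.InjOn f H ∧ ∀ h ∈ H, c h ≤ f h ∧ f h ≤ c h + n ∧ f h ∉ F := by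
  classical
  induction H using Finset.induction_on with
  | empty => exact ⟨c, by simp, by simp⟩
  | insert a H ha ih =>
    rw [Finset.card_insert_of_notMem ha] at hcard
    obtain ⟨f, hinj, hf⟩ := ih (by omega)
    obtain ⟨x, hx, hxF⟩ : ∃ x ∈ Finset.Icc (c a) (c a + n), x ∉ F ∪ H.image f := by
      apply Finset.exists_mem_notMem_of_card_lt_card
      have h₁ := Finset.card_union_le F (H.image f)
      have h₂ : (H.image f).card ≤ H.card := Finset.card_image_le
      rw [Nat.card_Icc]
      omega
    rw [Finset.mem_Icc] at hx
    simp only [Finset.mem_union, Finset.mem_image, not_or, not_exists, not_and] at hxF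
    have hne : ∀ h ∈ H, h ≠ a := fun h hh => ne_of_mem_of_not_mem hh ha
    refine ⟨Function.update f a x, ?_, ?_⟩
    · rw [Finset.coe_insert, Set.injOn_insert (by simpa using ha)]
      refine ⟨fun b hb d hd hbd => ?_, ?_⟩
      · rw [Function.update_of_ne (hne b hb), Function.update_of_ne (hne d hd)] at hbd
        exact hinj hb hd hbd
      · rintro ⟨b, hb, hbx⟩
        rw [Function.update_of_ne (hne b hb), Function.update_self] at hbx
        exact hxF.2 b hb hbx
    · intro h hh
      rcases Finset.mem_insert.mp hh with rfl | hh
      · simpa using ⟨hx.1, hx.2, hxF.1⟩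
      · rw [Function.update_of_ne (hne h hh)]
        exact hf h hh

open Classical in
/-- The vertices outside `S` with a neighbor in `M`. -/
noncomputable def outerNeighbors [Fintype V] (G : SimpleGraph V) (S M : Finset V) : Finset V :=
  Finset.univ.filter fun x => x ∉ S ∧ ∃ m ∈ M, G.Adj m x

/-- There is a subset `M` of `S` with few neighbors outside `S` such that every other vertex of `S`
has many neighbors outside `S` that are not adjacent to `M`. -/
lemma exists_subset_outerNeighbors [Fintype V] [DecidableEq V] (G : SimpleGraph V) (S : Finset V)
    (n : ℕ) :
    ∃ M ⊆ S, (outerNeighbors G S M).card ≤ n * M.card ∧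
      ∀ h ∈ S \ M, n < (outerNeighbors G S {h} \ outerNeighbors G S M).card := by
  obtain ⟨M, hM, hmax⟩ := Finset.exists_max_image
    (S.powerset.filter fun M => (outerNeighbors G S M).card ≤ n * M.card) Finset.card
    ⟨∅, Finset.mem_filter.mpr ⟨Finset.empty_mem_powerset S, by simp [outerNeighbors]⟩⟩
  simp only [Finset.mem_filter, Finset.mem_powerset] at hM hmax
  refine ⟨M, hM.1, hM.2, fun h hh => ?_⟩
  rw [Finset.mem_sdiff] at hh
  by_contra! hle
  have hsub : outerNeighbors G S (insert h M) ⊆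
      (outerNeighbors G S {h} \ outerNeighbors G S M) ∪ outerNeighbors G S M := by
    intro x
    simp only [outerNeighbors, Finset.mem_filter, Finset.mem_univ, true_and, Finset.mem_insert,
      Finset.mem_union, Finset.mem_sdiff, Finset.mem_singleton]
    grind
  have h₁ := (Finset.card_le_card hsub).trans (Finset.card_union_le _ _)
  have hins := Finset.card_insert_of_notMem hh.2
  have h₂ := hmax (insert h M) ⟨Finset.insert_subset hh.1 hM.1, by rw [hins]; linarith⟩
  omega

open Classical in
/-- Keep the weights of the edges inside `T`, give weight `1` to the edges joining a vertex `h` to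
an element of `A h`, and give weight `0` to all other edges. -/
noncomputable def modifiedWeight (w : Sym2 V → Fin 2) (T : Finset V) (A : V → Finset V)
    (e : Sym2 V) : Fin 2 :=
  if ((∀ x ∈ e, x ∈ T) ∧ w e = 1) ∨ ∃ h, ∃ x ∈ A h, e = s(h, x) then 1 else 0

lemma modifiedWeight_eq_one_iff (w : Sym2 V → Fin 2) (T : Finset V) (A : V → Finset V) (u v : V) :
    modifiedWeight w T A s(u, v) = 1 ↔
      (u ∈ T ∧ v ∈ T ∧ w s(u, v) = 1) ∨ v ∈ A u ∨ u ∈ A v := by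
  have hext : (∃ h, ∃ x ∈ A h, s(u, v) = s(h, x)) ↔ v ∈ A u ∨ u ∈ A v := by
    simp only [Sym2.eq_iff]
    grind
  simp only [modifiedWeight, hext, Sym2.mem_iff, forall_eq_or_imp, forall_eq, and_assoc,
    ite_eq_left_iff, zero_ne_one, imp_false, not_not]

/-- If a finite simple graph with a vertex cover of size at most `k`
admits a proper `{0,1}`-edge-weighting, then it admits one assigning weight `1`
to at most `k(8k² + 8k)` edges. -/
theorem stmt_1 [Finite V] (G : SimpleGraph V) (k : ℕ) (S : Set V)
    (hvc : IsVertexCover G S) (hS : S.ncard ≤ k)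
    (hex : ∃ w : Sym2 V → Fin 2, vcProper G w) :
    ∃ w2 : Sym2 V → Fin 2, vcProper G w2 ∧
      {e | e ∈ G.edgeSet ∧ w2 e = 1}.ncard ≤ k * (8 * k ^ 2 + 8 * k) := by
  classical
  have := Fintype.ofFinite V
  obtain ⟨w, hw⟩ := hex
  obtain ⟨S, rfl⟩ : ∃ S' : Finset V, S = S' := ⟨S.toFinite.toFinset, by simp⟩
  rw [Set.ncard_coe_finset] at hS
  simp only [IsVertexCover, Finset.mem_coe] at hvc
  obtain ⟨M, hMS, hJcard, hmany⟩ := exists_subset_outerNeighbors G S (2 * k)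
  set J := outerNeighbors G S M with hJdef
  have hJ : ∀ x, x ∈ J ↔ x ∉ S ∧ ∃ m ∈ M, G.Adj m x := by simp [hJdef, outerNeighbors]
  set c : V → ℕ := fun h =>
    (Finset.univ.filter fun u => G.Adj h u ∧ u ∈ S ∪ J ∧ w s(h, u) = 1).card with hc
  obtain ⟨f, hinj, hf⟩ := exists_injOn_mem_Icc_notMem (S \ M) c
    (Finset.range (k + 1) ∪ M.image (vcColor G w)) (2 * k) (by
      have h₁ := Finset.card_union_le (Finset.range (k + 1)) (M.image (vcColor G w))
      have h₂ : (M.image (vcColor G w)).card ≤ M.card := Finset.card_image_le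
      have h₃ := Finset.card_sdiff_add_card_eq_card hMS
      rw [Finset.card_range] at h₁
      omega)
  have hA : ∀ h, ∃ A : Finset V, (h ∉ S \ M → A = ∅) ∧
      (h ∈ S \ M → A ⊆ outerNeighbors G S {h} \ J ∧ A.card = f h - c h) := by
    intro h
    by_cases hh : h ∈ S \ M
    · obtain ⟨A, hA, hAc⟩ := Finset.exists_subset_card_eq
        (s := outerNeighbors G S {h} \ J) (n := f h - c h) (by
          have := hf h hh
          have := hmany h hh
          omega)
      exact ⟨A, fun h => absurd hh h, fun _ => ⟨hA, hAc⟩⟩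
    · exact ⟨∅, fun _ => rfl, fun h => absurd h hh⟩
  choose A hA₀ hA₁ using hA
  have hAmem : ∀ h x, x ∈ A h → h ∈ S ∧ h ∉ M ∧ x ∉ S ∧ x ∉ J ∧ G.Adj h x := by
    intro h x hx
    by_cases hh : h ∈ S \ M
    · have := (hA₁ h hh).1 hx
      simp only [outerNeighbors, Finset.mem_sdiff, Finset.mem_filter, Finset.mem_univ, true_and,
        Finset.mem_singleton, exists_eq_left] at this hh
      exact ⟨hh.1, hh.2, this.1.1, this.2, this.1.2⟩
    · simp [hA₀ h hh] at hx
  have hAcard : ∀ h, (A h).card ≤ 2 * k := by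
    intro h
    by_cases hh : h ∈ S \ M
    · have := hf h hh
      have := (hA₁ h hh).2
      omega
    · simp [hA₀ h hh]
  set w2 := modifiedWeight w (S ∪ J) A
  have hw2 : ∀ u v, w2 s(u, v) = 1 ↔
      (u ∈ S ∪ J ∧ v ∈ S ∪ J ∧ w s(u, v) = 1) ∨ v ∈ A u ∨ u ∈ A v :=
    modifiedWeight_eq_one_iff w (S ∪ J) A
  have hkeep : ∀ v, v ∈ M ∨ v ∈ J → vcColor G w2 v = vcColor G w v := by
    intro v hv
    rw [vcColor_eq_card, vcColor_eq_card]
    congr 1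
    ext u
    simp only [Finset.mem_filter, Finset.mem_univ, true_and, hw2, Finset.mem_union]
    have h₁ := hAmem u v
    have h₂ := hAmem v u
    have h₃ := hJ u
    have h₄ := hJ v
    have h₅ := @hvc v u
    have h₆ := @hMS v
    grind
  have hnew : ∀ h ∈ S \ M, vcColor G w2 h = f h := by
    intro h hh
    have hdisj : Disjoint
        (Finset.univ.filter fun u => G.Adj h u ∧ u ∈ S ∪ J ∧ w s(h, u) = 1) (A h) := by
      rw [Finset.disjoint_left]
      intro x hx hxA
      have := hAmem h x hxA
      simp only [Finset.mem_filter, Finset.mem_union] at hx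
      tauto
    have hunion : (Finset.univ.filter fun u => G.Adj h u ∧ w2 s(h, u) = 1) =
        (Finset.univ.filter fun u => G.Adj h u ∧ u ∈ S ∪ J ∧ w s(h, u) = 1) ∪ A h := by
      ext u
      simp only [Finset.mem_filter, Finset.mem_univ, true_and, hw2, Finset.mem_union]
      have h₁ := hAmem u h
      have h₂ := hAmem h u
      rw [Finset.mem_sdiff] at hh
      tauto
    rw [vcColor_eq_card, hunion, Finset.card_union_of_disjoint hdisj, (hA₁ h hh).2]
    exact Nat.add_sub_cancel' (hf h hh).1
  have hsmall : ∀ v ∉ S, vcColor G w2 v ≤ k := by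
    intro v hv
    rw [vcColor_eq_card]
    refine le_trans (Finset.card_le_card (t := S) fun u hu => ?_) hS
    rw [Finset.mem_filter] at hu
    exact (hvc hu.2.1).resolve_left hv
  have havoid : ∀ h ∈ S \ M, k < f h ∧ ∀ m ∈ M, vcColor G w m ≠ f h := by
    intro h hh
    have hF := (hf h hh).2.2
    simp only [Finset.mem_union, Finset.mem_range, Finset.mem_image, not_or, not_exists,
      not_and] at hF
    exact ⟨by omega, hF.2⟩
  have hproper : ∀ u ∈ S, ∀ v, G.Adj u v → vcColor G w2 u ≠ vcColor G w2 v := by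
    intro u hu v huv
    by_cases huM : u ∈ M
    · rw [hkeep u (Or.inl huM)]
      by_cases hvS : v ∈ S
      · by_cases hvM : v ∈ M
        · rw [hkeep v (Or.inl hvM)]
          exact hw u v huv
        · have hv := Finset.mem_sdiff.mpr ⟨hvS, hvM⟩
          rw [hnew v hv]
          exact (havoid v hv).2 u huM
      · rw [hkeep v (Or.inr ((hJ v).mpr ⟨hvS, u, huM, huv⟩))]
        exact hw u v huv
    · have hu' := Finset.mem_sdiff.mpr ⟨hu, huM⟩
      rw [hnew u hu']
      by_cases hvS : v ∈ S
      · by_cases hvM : v ∈ M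
        · rw [hkeep v (Or.inl hvM)]
          exact ((havoid u hu').2 v hvM).symm
        · have hv := Finset.mem_sdiff.mpr ⟨hvS, hvM⟩
          rw [hnew v hv]
          exact fun h => huv.ne (hinj hu' hv h)
      · have := hsmall v hvS
        have := (havoid u hu').1
        omega
  refine ⟨w2, fun u v huv => ?_, ?_⟩
  · rcases hvc huv with hu | hv
    · exact hproper u hu v huv
    · exact (hproper v hv u huv.symm).symm
  have hcover : {e | e ∈ G.edgeSet ∧ w2 e = 1} ⊆
      ↑(S.biUnion fun a => (S ∪ J ∪ A a).image fun b => s(a, b)) := by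
    have key : ∀ a ∈ S, ∀ b, w2 s(a, b) = 1 →
        s(a, b) ∈ S.biUnion fun a => (S ∪ J ∪ A a).image fun b => s(a, b) := by
      intro a ha b hab
      refine Finset.mem_biUnion.mpr ⟨a, ha, Finset.mem_image_of_mem _ ?_⟩
      have h₁ := hAmem b a
      rw [hw2] at hab
      rw [Finset.mem_union]
      tauto
    rintro e ⟨he, hwe⟩
    induction e with
    | h a b =>
      rcases hvc he with ha | hb
      · exact key a ha b hwe
      · rw [Sym2.eq_swap] at hwe ⊢
        exact key b hb a hwe
  refine (Set.ncard_le_ncard hcover (Finset.finite_toSet _)).trans ?_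
  rw [Set.ncard_coe_finset]
  refine (Finset.card_biUnion_le_card_mul _ _ (8 * k ^ 2 + 8 * k) fun a _ => ?_).trans
    (Nat.mul_le_mul_right _ hS)
  refine Finset.card_image_le.trans ?_
  have h₁ := Finset.card_union_le (S ∪ J) (A a)
  have h₂ := Finset.card_union_le S J
  have h₃ := hAcard a
  have h₄ : 2 * k * M.card ≤ 2 * k * k :=
    Nat.mul_le_mul_left _ ((Finset.card_le_card hMS).trans hS)
  nlinarith
end

section
/- Let G be a finite simple graph, let k be a positive integer, and let A be a set of vertices of G that pairwise have the same open neighborhood S' ⊆ V(G), where |S'| ≤ 2k. Let w : E(G) → {0,1} be a proper weight function such that color_w(v) ≤ 8k² + 8k for every vertex v of G. Then at most 2k(8k² + 8k) vertices of A have color_w different from 0; that is, all but at most 2k(8k² + 8k) vertices of A have color 0 under w. -/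
variable {V : Type*}

/-- The number of neighbours of `s` joined to it by an edge of nonzero weight is at most
the color of `s`. -/
theorem ncard_weighted_neighbors_le_vcColor [Finite V] (G : SimpleGraph V)
    (w : Sym2 V → Fin 2) (s : V) :
    {v | G.Adj s v ∧ w s(s, v) ≠ 0}.ncard ≤ vcColor G w s := by
  classical
  have hfin := Set.toFinite {v | G.Adj s v ∧ w s(s, v) ≠ 0}
  rw [Set.ncard_eq_toFinset_card _ hfin, Finset.card_eq_sum_ones]
  calc ∑ v ∈ hfin.toFinset, 1
      ≤ ∑ v ∈ hfin.toFinset, (w s(s, v) : ℕ) := by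
        refine Finset.sum_le_sum fun v hv => ?_
        have hv' : G.Adj s v ∧ w s(s, v) ≠ 0 := by simpa using hv
        exact Nat.one_le_iff_ne_zero.mpr fun h => hv'.2 (Fin.ext h)
    _ = ∑ e ∈ hfin.toFinset.image (fun v => s(s, v)), (w e : ℕ) := by
        rw [Finset.sum_image fun _ _ _ _ h => Sym2.congr_right.mp h]
    _ ≤ vcColor G w s := by
        refine Finset.sum_le_sum_of_subset fun e he => ?_
        obtain ⟨v, hv, rfl⟩ := Finset.mem_image.mp he
        have hv' : G.Adj s v ∧ w s(s, v) ≠ 0 := by simpa using hv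
        simpa using hv'.1

/-- A vertex of nonzero color is incident to an edge of nonzero weight. -/
theorem exists_adj_weight_ne_zero_of_vcColor_ne_zero [Finite V] {G : SimpleGraph V}
    {w : Sym2 V → Fin 2} {v : V} (hv : vcColor G w v ≠ 0) :
    ∃ s, G.Adj v s ∧ w s(v, s) ≠ 0 := by
  obtain ⟨e, he, hwe⟩ := Finset.exists_ne_zero_of_sum_ne_zero hv
  obtain ⟨heG, hve⟩ := (Set.Finite.mem_toFinset _).mp he
  obtain ⟨s, rfl⟩ := Sym2.mem_iff_exists.mp hve
  exact ⟨s, heG, fun h => hwe (by simp [h])⟩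

/-- Let `A` be a set of vertices pairwise having the same open neighborhood
`S'` with `|S'| ≤ 2k`.  If `w` is a proper weighting whose colors are all at most `8k² + 8k`,
then at most `2k(8k² + 8k)` vertices of `A` have nonzero color. -/
theorem stmt_3 [Finite V] (G : SimpleGraph V) (k : ℕ) (hk : 0 < k)
    (A : Set V) (S' : Set V) (hS' : S'.ncard ≤ 2 * k)
    (hnb : ∀ v ∈ A, G.neighborSet v = S')
    (w : Sym2 V → Fin 2) (hp : vcProper G w)
    (hbd : ∀ v : V, vcColor G w v ≤ 8 * k ^ 2 + 8 * k) :
    {v ∈ A | vcColor G w v ≠ 0}.ncard ≤ 2 * k * (8 * k ^ 2 + 8 * k) := by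
  have hfin := Set.toFinite S'
  have hsub : {v ∈ A | vcColor G w v ≠ 0} ⊆
      ⋃ s ∈ hfin.toFinset, {v | G.Adj s v ∧ w s(s, v) ≠ 0} := by
    rintro v ⟨hvA, hv⟩
    obtain ⟨s, hs, hws⟩ := exists_adj_weight_ne_zero_of_vcColor_ne_zero hv
    have hsS : s ∈ S' := hnb v hvA ▸ hs
    exact Set.mem_biUnion (hfin.mem_toFinset.mpr hsS) ⟨hs.symm, Sym2.eq_swap ▸ hws⟩
  calc {v ∈ A | vcColor G w v ≠ 0}.ncard
      ≤ (⋃ s ∈ hfin.toFinset, {v | G.Adj s v ∧ w s(s, v) ≠ 0}).ncard := Set.ncard_le_ncard hsub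
    _ ≤ ∑ s ∈ hfin.toFinset, {v | G.Adj s v ∧ w s(s, v) ≠ 0}.ncard :=
        Finset.set_ncard_biUnion_le _ _
    _ ≤ hfin.toFinset.card * (8 * k ^ 2 + 8 * k) :=
        Finset.sum_le_card_nsmul _ _ _ fun s _ =>
          (ncard_weighted_neighbors_le_vcColor G w s).trans (hbd s)
    _ ≤ 2 * k * (8 * k ^ 2 + 8 * k) := by
        rw [← Set.ncard_eq_toFinset_card S' hfin]
        gcongr
end

section
/- Let G be a finite simple graph admitting a vertex cover of size at most k, and let S be a vertex cover of G with |S| ≤ 2k. Let U ⊆ V(G) be a set with S ⊆ U such that for every vertex v ∈ V(G) \ U there are at least 2k(8k² + 8k) + 1 vertices u ∈ U \ S with N_G(u) = N_G(v). Then G admits a proper weight function if and only if the induced subgraph G[U] admits a proper weight function. -/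
variable {V : Type*}

/-- The color of `v` counts the edges of weight one at `v`. -/
lemma vcColor_eq_ncard [Finite V] (G : SimpleGraph V) (w : Sym2 V → Fin 2) (v : V) :
    vcColor G w v = {u | G.Adj v u ∧ w s(v, u) = 1}.ncard := by
  classical
  have hw : ∀ e : Sym2 V, (w e : ℕ) = if w e = 1 then 1 else 0 := fun e => by
    generalize w e = a
    fin_cases a <;> rfl
  unfold vcColor
  rw [Finset.sum_congr rfl fun e _ => hw e, ← Finset.card_filter, ← Set.ncard_coe_finset]
  symm
  refine Set.ncard_congr (fun u _ => s(v, u)) ?_ ?_ ?_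
  · rintro u ⟨h, h1⟩
    simp [SimpleGraph.incidenceSet, h, h1]
  · intro a b _ _ h
    exact Sym2.congr_right.1 h
  · intro e he
    simp only [Finset.coe_filter, Set.Finite.mem_toFinset, Set.mem_ofPred_eq] at he
    obtain ⟨⟨h1, h2⟩, h3⟩ := he
    obtain ⟨u, rfl⟩ := Sym2.mem_iff_exists.1 h2
    exact ⟨u, ⟨h1, h3⟩, rfl⟩

/-- Proper weight functions correspond to subgraphs `H` (the edges of weight one) whose degrees
separate adjacent vertices of `G`. -/
lemma exists_vcProper_iff [Finite V] (G : SimpleGraph V) :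
    (∃ w : Sym2 V → Fin 2, vcProper G w) ↔
      ∃ H ≤ G, ∀ u v, G.Adj u v → (H.neighborSet u).ncard ≠ (H.neighborSet v).ncard := by
  classical
  constructor
  · rintro ⟨w, hw⟩
    refine ⟨⟨fun u v => G.Adj u v ∧ w s(u, v) = 1, ⟨fun u v h => ⟨h.1.symm, Sym2.eq_swap ▸ h.2⟩⟩,
      ⟨fun u h => G.irrefl h.1⟩⟩, fun u v h => h.1, fun u v h => ?_⟩
    have := hw u v h
    rwa [vcColor_eq_ncard, vcColor_eq_ncard] at this
  · rintro ⟨H, hHG, hH⟩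
    refine ⟨fun e => if e ∈ H.edgeSet then 1 else 0, fun u v h => ?_⟩
    have key : ∀ x, {y | G.Adj x y ∧ (if s(x, y) ∈ H.edgeSet then (1 : Fin 2) else 0) = 1} =
        H.neighborSet x := fun x => by
      ext y
      by_cases hxy : H.Adj x y
      · simp [hxy, hHG hxy]
      · simp [hxy]
    rw [vcColor_eq_ncard, vcColor_eq_ncard, key, key]
    exact hH u v h

/-- `H` is a set of weight-one edges of `G` inducing a proper coloring of `G[W]`. -/
def SeparatesOn (G H : SimpleGraph V) (W : Set V) : Prop :=
  H ≤ G ∧ ∀ u ∈ W, ∀ v ∈ W, G.Adj u v →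
    (H.neighborSet u ∩ W).ncard ≠ (H.neighborSet v ∩ W).ncard

lemma exists_vcProper_iff_separatesOn_univ [Finite V] (G : SimpleGraph V) :
    (∃ w : Sym2 V → Fin 2, vcProper G w) ↔ ∃ H, SeparatesOn G H Set.univ := by
  simp [exists_vcProper_iff, SeparatesOn]

lemma exists_vcProper_induce_iff_separatesOn [Finite V] (G : SimpleGraph V) (U : Set V) :
    (∃ w : Sym2 ↥U → Fin 2, vcProper (G.induce U) w) ↔ ∃ H, SeparatesOn G H U := by
  rw [exists_vcProper_iff]
  constructor
  · rintro ⟨H, hHG, hH⟩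
    have key : ∀ x : U, (H.map (Function.Embedding.subtype _)).neighborSet x ∩ U =
        Subtype.val '' H.neighborSet x := fun x => by
      ext y
      constructor
      · rintro ⟨h, hy⟩
        obtain ⟨a, b, hab, ha, rfl⟩ := (SimpleGraph.map_adj _ _ _ _).1 h
        obtain rfl : a = x := Subtype.ext ha
        exact ⟨b, hab, rfl⟩
      · rintro ⟨b, hb, rfl⟩
        exact ⟨(SimpleGraph.map_adj _ _ _ _).2 ⟨x, b, hb, rfl, rfl⟩, b.2⟩
    refine ⟨H.map (Function.Embedding.subtype _), ?_, fun u hu v hv h => ?_⟩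
    · exact (SimpleGraph.map_le_iff_le_comap _ _ _).2 hHG
    · rw [key ⟨u, hu⟩, key ⟨v, hv⟩, Set.ncard_image_of_injective _ Subtype.val_injective,
        Set.ncard_image_of_injective _ Subtype.val_injective]
      exact hH _ _ h
  · rintro ⟨H, hHG, hH⟩
    have key : ∀ x : U, ((H.induce U).neighborSet x).ncard = (H.neighborSet x ∩ U).ncard :=
      fun x => by
        rw [← Set.ncard_image_of_injective _ Subtype.val_injective]
        congr 1
        ext y
        simp
    refine ⟨H.induce U, fun u v h => hHG h, fun u v h => ?_⟩
    rw [key, key]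
    exact hH u u.2 v v.2 h

/-- Distinct values above `s` and outside `F` can be picked from sufficiently long intervals. -/
lemma exists_injective_avoiding {ι : Type*} [Finite ι] (b m : ι → ℕ) (s : ℕ) (F : Finset ℕ)
    (hm : ∀ i, Nat.card ι + s + F.card ≤ m i) :
    ∃ a : ι → ℕ, (∀ i, a i ≤ m i) ∧ Function.Injective (fun i => b i + a i) ∧
      ∀ i, s < b i + a i ∧ b i + a i ∉ F := by
  classical
  let t : ι → Finset ℕ := fun i => (Finset.Icc (b i) (b i + m i) \ Finset.range (s + 1)) \ F
  have ht : ∀ i, Nat.card ι ≤ (t i).card := fun i => by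
    have h1 := Finset.le_card_sdiff F (Finset.Icc (b i) (b i + m i) \ Finset.range (s + 1))
    have h2 := Finset.le_card_sdiff (Finset.range (s + 1)) (Finset.Icc (b i) (b i + m i))
    have := hm i
    simp only [Nat.card_Icc, Finset.card_range] at h1 h2
    change _ ≤ ((Finset.Icc (b i) (b i + m i) \ Finset.range (s + 1)) \ F).card
    omega
  have : Fintype ι := Fintype.ofFinite ι
  obtain ⟨c, hc, hct⟩ := (Finset.all_card_le_biUnion_card_iff_exists_injective t).1 fun A => by
    obtain rfl | ⟨i, hi⟩ := A.eq_empty_or_nonempty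
    · simp
    · calc A.card ≤ Fintype.card ι := A.card_le_univ
        _ = Nat.card ι := Nat.card_eq_fintype_card.symm
        _ ≤ (t i).card := ht i
        _ ≤ _ := Finset.card_le_card (Finset.subset_biUnion_of_mem t hi)
  have hmem : ∀ i, b i ≤ c i ∧ c i ≤ b i + m i ∧ s < c i ∧ c i ∉ F := fun i => by
    have := hct i
    simp only [t, Finset.mem_sdiff, Finset.mem_Icc, Finset.mem_range] at this
    grind
  have hadd : ∀ i, b i + (c i - b i) = c i := fun i => Nat.add_sub_cancel' (hmem i).1
  refine ⟨fun i => c i - b i, fun i => ?_, ?_, fun i => ?_⟩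
  · have := hmem i
    change c i - b i ≤ m i
    omega
  · simpa only [hadd] using hc
  · simpa only [hadd] using (hmem i).2.2

/-- If every vertex outside `U` has enough twins in `U \ S`, for a vertex cover `S ⊆ U`, then a
proper coloring of `G[W₁]` can be transferred to `G[W₂]` whenever `U ⊆ W₁` and `U ⊆ W₂`. -/
lemma SeparatesOn.transfer [Finite V] {G H : SimpleGraph V} {S U W₁ W₂ : Set V}
    (hvc : IsVertexCover G S) (hSU : S ⊆ U)
    (htw : ∀ v, v ∉ U →
      3 * S.ncard ≤ {u : V | u ∈ U \ S ∧ G.neighborSet u = G.neighborSet v}.ncard)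
    (hU₁ : U ⊆ W₁) (hU₂ : U ⊆ W₂) (hH : SeparatesOn G H W₁) :
    ∃ H', SeparatesOn G H' W₂ := by
  classical
  obtain ⟨hHG, hH⟩ := hH
  -- the vertices whose colors are affected by the change of vertex set
  let B : Set V := {x | ∃ v, v ∉ U ∧ G.Adj v x}
  have hB : ∀ {u v}, u ∉ U → G.Adj u v → v ∈ B := fun {u v} hu h => ⟨u, hu, h⟩
  have hBS : B ⊆ S := fun x ⟨v, hv, h⟩ => (hvc h).resolve_left fun h' => hv (hSU h')
  choose f hfU hfx using fun x : B => x.2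
  let T : B → Set V := fun x => {u | u ∈ U \ S ∧ G.neighborSet u = G.neighborSet (f x)}
  have hTB : ∀ {x u v}, u ∈ T x → G.Adj u v → v ∈ B := fun {x u v} hu h => by
    have : v ∈ G.neighborSet u := h
    rw [hu.2] at this
    exact hB (hfU x) this
  have hTadj : ∀ {x : B} {u}, u ∈ T x → G.Adj x u := fun {x u} hu => by
    have : (x : V) ∈ G.neighborSet (f x) := hfx x
    rw [← hu.2] at this
    exact SimpleGraph.Adj.symm this
  let F : Finset ℕ := (S.toFinite.toFinset).image fun y => (H.neighborSet y ∩ W₁).ncard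
  have hF : F.card ≤ S.ncard := by
    rw [Set.ncard_eq_toFinset_card S S.toFinite]
    exact Finset.card_image_le
  have hBc : Nat.card B ≤ S.ncard := Set.ncard_le_ncard hBS
  obtain ⟨a, ham, hinj, ha⟩ := exists_injective_avoiding
    (fun x : B => ((H.neighborSet x ∩ U) \ T x).ncard) (fun x => (T x).ncard) S.ncard F
    fun x => by
      have := htw (f x) (hfU x)
      change _ ≤ (T x).ncard at this
      omega
  choose A hAT hAc using fun x : B => Set.exists_subset_card_eq (ham x)
  let M : V → V → Prop := fun x u => ∃ h : x ∈ B, u ∈ T ⟨x, h⟩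
  let N : V → V → Prop := fun x u => ∃ h : x ∈ B, u ∈ A ⟨x, h⟩
  have hNM : ∀ {x u}, N x u → M x u := fun {x u} ⟨h, hu⟩ => ⟨h, hAT _ hu⟩
  have hMS : ∀ {x u}, M x u → u ∉ S := fun {x u} ⟨h, hu⟩ => hu.1.2
  have hMG : ∀ {x u}, M x u → G.Adj x u := fun {x u} ⟨h, hu⟩ => hTadj hu
  let H' : SimpleGraph V :=
    { Adj := fun u v => u ∈ U ∧ v ∈ U ∧ ((H.Adj u v ∧ ¬ M u v ∧ ¬ M v u) ∨ N u v ∨ N v u)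
      symm := ⟨fun u v h => ⟨h.2.1, h.1, by have := H.adj_comm u v; tauto⟩⟩
      loopless := ⟨fun u h => by
        rcases h.2.2 with h | h | h
        · exact H.irrefl h.1
        · exact G.irrefl (hMG (hNM h))
        · exact G.irrefl (hMG (hNM h))⟩ }
  have hH'G : H' ≤ G := fun u v h => by
    rcases h.2.2 with h | h | h
    · exact hHG h.1
    · exact hMG (hNM h)
    · exact (hMG (hNM h)).symm
  have hcolB : ∀ x : B, (H'.neighborSet x ∩ W₂).ncard =
      ((H.neighborSet x ∩ U) \ T x).ncard + a x := fun x => by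
    rw [← hAc x, ← Set.ncard_union_eq (Set.disjoint_sdiff_left.mono_right (hAT x))]
    congr 1
    ext u
    have h1 : M x u ↔ u ∈ T x := ⟨fun ⟨_, h⟩ => h, fun h => ⟨x.2, h⟩⟩
    have h2 : N x u ↔ u ∈ A x := ⟨fun ⟨_, h⟩ => h, fun h => ⟨x.2, h⟩⟩
    have h3 : ¬ M u x := fun h => hMS h (hBS x.2)
    have h4 : ¬ N u x := fun h => h3 (hNM h)
    have h5 : (x : V) ∈ U := hSU (hBS x.2)
    have h6 : u ∈ A x → u ∈ U := fun h => (hAT x h).1.1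
    have h7 : u ∈ U → u ∈ W₂ := fun h => hU₂ h
    change ((x : V) ∈ U ∧ u ∈ U ∧ ((H.Adj x u ∧ ¬ M x u ∧ ¬ M u x) ∨ N x u ∨ N u x)) ∧ u ∈ W₂ ↔
      ((H.Adj x u ∧ u ∈ U) ∧ ¬ u ∈ T x) ∨ u ∈ A x
    simp only [h1, h2, h3, h4, h5, not_false_eq_true, and_true, true_and, or_false]
    constructor
    · rintro ⟨⟨hu, h | h⟩, _⟩
      · exact Or.inl ⟨⟨h.1, hu⟩, h.2⟩
      · exact Or.inr h
    · rintro (⟨⟨h, hu⟩, hT⟩ | h)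
      · exact ⟨⟨hu, Or.inl ⟨h, hT⟩⟩, h7 hu⟩
      · exact ⟨⟨h6 h, Or.inr h⟩, h7 (h6 h)⟩
  have hcol : ∀ v ∈ U, v ∉ B → (∀ x, ¬ M x v) →
      H'.neighborSet v ∩ W₂ = H.neighborSet v ∩ W₁ := fun v hv hvB hvM => by
    ext u
    have h1 : ¬ M v u := fun ⟨h, _⟩ => hvB h
    have h2 : ¬ N v u := fun h => h1 (hNM h)
    have h3 : ¬ M u v := hvM u
    have h4 : ¬ N u v := fun h => h3 (hNM h)
    have h5 : H.Adj v u → u ∈ U := fun h => by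
      by_contra hu
      exact hvB (hB hu (hHG h).symm)
    have h6 : u ∈ U → u ∈ W₁ ∧ u ∈ W₂ := fun h => ⟨hU₁ h, hU₂ h⟩
    change (v ∈ U ∧ u ∈ U ∧ ((H.Adj v u ∧ ¬ M v u ∧ ¬ M u v) ∨ N v u ∨ N u v)) ∧ u ∈ W₂ ↔
      H.Adj v u ∧ u ∈ W₁
    simp only [h1, h2, h3, h4, hv, not_false_eq_true, and_true, true_and, or_false]
    exact ⟨fun h => ⟨h.1.2, (h6 h.1.1).1⟩, fun h => ⟨⟨h5 h.1, h.1⟩, (h6 (h5 h.1)).2⟩⟩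
  have hsmall : ∀ v ∉ S, (H'.neighborSet v ∩ W₂).ncard ≤ S.ncard := fun v hv =>
    Set.ncard_le_ncard fun u hu => (hvc (hH'G hu.1)).resolve_left hv
  have hBne : ∀ u ∈ B, ∀ v, G.Adj u v →
      (H'.neighborSet u ∩ W₂).ncard ≠ (H'.neighborSet v ∩ W₂).ncard := by
    intro u hu v huv
    have hcu := hcolB ⟨u, hu⟩
    obtain ⟨hlt, hnF⟩ := ha ⟨u, hu⟩
    rw [← hcu] at hlt hnF
    by_cases hvB : v ∈ B
    · intro h
      rw [hcu, hcolB ⟨v, hvB⟩] at h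
      exact huv.ne (congrArg Subtype.val (hinj h))
    by_cases hvS : v ∈ S
    · rw [hcol v (hSU hvS) hvB fun x h => hMS h hvS]
      intro h
      exact hnF (Finset.mem_image.2 ⟨v, by simpa using hvS, h.symm⟩)
    · have := hsmall v hvS
      change S.ncard < (H'.neighborSet u ∩ W₂).ncard at hlt
      omega
  refine ⟨H', hH'G, fun u _ v _ huv => ?_⟩
  by_cases hu : u ∈ B
  · exact hBne u hu v huv
  by_cases hv : v ∈ B
  · exact (hBne v hv u huv.symm).symm
  have huU : u ∈ U := by
    by_contra h
    exact hv (hB h huv)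
  have hvU : v ∈ U := by
    by_contra h
    exact hu (hB h huv.symm)
  rw [hcol u huU hu fun x ⟨_, h⟩ => hv (hTB h huv),
    hcol v hvU hv fun x ⟨_, h⟩ => hu (hTB h huv.symm)]
  exact hH u (hU₁ huU) v (hU₁ hvU) huv

/-- Kernelization correctness: if every vertex outside `U` has at least
`2k(8k² + 8k) + 1` twins inside `U \ S`, then `G` admits a proper weighting iff the
induced subgraph `G[U]` does. -/
theorem stmt_4 [Finite V] (G : SimpleGraph V) (k : ℕ)
    (S₀ : Set V) (hvc₀ : IsVertexCover G S₀) (hS₀ : S₀.ncard ≤ k)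
    (S : Set V) (hvc : IsVertexCover G S) (hS : S.ncard ≤ 2 * k)
    (U : Set V) (hSU : S ⊆ U)
    (htw : ∀ v : V, v ∉ U →
      2 * k * (8 * k ^ 2 + 8 * k) + 1 ≤
        {u : V | u ∈ U \ S ∧ G.neighborSet u = G.neighborSet v}.ncard) :
    (∃ w : Sym2 V → Fin 2, vcProper G w) ↔
      (∃ w : Sym2 ↥U → Fin 2, vcProper (G.induce U) w) := by
  have htw' : ∀ v, v ∉ U →
      3 * S.ncard ≤ {u : V | u ∈ U \ S ∧ G.neighborSet u = G.neighborSet v}.ncard := fun v hv => by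
    refine le_trans ?_ (htw v hv)
    rcases Nat.eq_zero_or_pos k with rfl | hk
    · omega
    · nlinarith [Nat.mul_le_mul hk hk, Nat.mul_le_mul (Nat.mul_le_mul hk hk) hk]
  rw [exists_vcProper_iff_separatesOn_univ, exists_vcProper_induce_iff_separatesOn]
  exact ⟨fun ⟨_, h⟩ => h.transfer hvc hSU htw' (Set.subset_univ U) subset_rfl,
    fun ⟨_, h⟩ => h.transfer hvc hSU htw' subset_rfl (Set.subset_univ U)⟩
end

section
/- Let G be a finite simple graph, let X ⊆ V(G) and B ⊆ X be such that no edge of G joins a vertex of X \ B to a vertex of V(G) \ X, and let E_X be a set of edges of G with both endpoints in X that contains every edge of G[X] having at least one endpoint in X \ B (so every edge of G with both endpoints in X that lies outside E_X has both endpoints in B). Let f : B → ℕ × ℕ, and let H₁ and H₂ be two partial solutions of state f. If (H₁, f) is extendable, then (H₂, f) is extendable. -/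
variable {V : Type*}

/-- Degree of a vertex in a (not necessarily decidable) graph. -/
noncomputable def subDeg (H : SimpleGraph V) (v : V) : ℕ := (H.neighborSet v).ncard

/-- A solution to `G`: a spanning subgraph in which adjacent (in `G`) vertices
have distinct degrees. -/
def IsSolution (G H : SimpleGraph V) : Prop :=
  H ≤ G ∧ ∀ a b : V, G.Adj a b → subDeg H a ≠ subDeg H b

/-- A partial solution of state `f` (on the boundary `B`, with allowed edge set `EX`):
a graph `HX` with edges inside `EX` such that the second coordinate of `f` records the
current degrees on `B`, and no edge of `EX` creates a conflict of (final/current) degrees. -/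
def IsPartialSolution (B : Set V) (EX : Set (Sym2 V)) (f : V → ℕ × ℕ)
    (HX : SimpleGraph V) : Prop :=
  HX.edgeSet ⊆ EX ∧
  (∀ v ∈ B, (f v).2 = subDeg HX v) ∧
  (∀ u v : V, s(u, v) ∈ EX →
    ((u ∉ B ∧ v ∉ B) → subDeg HX u ≠ subDeg HX v) ∧
    ((u ∈ B ∧ v ∉ B) → subDeg HX v ≠ (f u).1) ∧
    ((u ∈ B ∧ v ∈ B) → (f u).1 ≠ (f v).1))

/-- `(HX, f)` is extendable: some solution `H` of `G` agrees with `HX` on `EX` and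
realizes the final/current degrees recorded by `f` on `B`. -/
def Extendable (G : SimpleGraph V) (B : Set V) (EX : Set (Sym2 V)) (f : V → ℕ × ℕ)
    (HX : SimpleGraph V) : Prop :=
  ∃ H : SimpleGraph V, IsSolution G H ∧ H.edgeSet ∩ EX = HX.edgeSet ∧
    ∀ v ∈ B, f v = (subDeg H v, subDeg HX v)

/-- If `HX` consists of the edges of `H` in `EX`, then each degree in `H` splits into the degree in
`HX` and the number of incident edges outside `EX`. -/
theorem subDeg_eq_add_ncard [Finite V] {EX : Set (Sym2 V)} {H HX : SimpleGraph V}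
    (h : H.edgeSet ∩ EX = HX.edgeSet) (v : V) :
    subDeg H v = subDeg HX v + {w | H.Adj v w ∧ s(v, w) ∉ EX}.ncard := by
  have key (w : V) : HX.Adj v w ↔ H.Adj v w ∧ s(v, w) ∈ EX := by
    rw [← SimpleGraph.mem_edgeSet, ← h, Set.mem_inter_iff, SimpleGraph.mem_edgeSet]
  unfold subDeg
  rw [← Set.ncard_union_eq _ (Set.toFinite _) (Set.toFinite _)]
  · congr 1
    ext w
    simp only [SimpleGraph.mem_neighborSet, Set.mem_union, Set.mem_ofPred_eq, key]
    tauto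
  · rw [Set.disjoint_left]
    intro w hw hw'
    exact hw'.2 ((key w).1 hw).2

theorem subDeg_eq_zero_of_notMem {X : Set V} {EX : Set (Sym2 V)} {HX : SimpleGraph V}
    (hEXX : ∀ e ∈ EX, ∀ v ∈ e, v ∈ X) (hHX : HX.edgeSet ⊆ EX) {v : V} (hv : v ∉ X) :
    subDeg HX v = 0 := by
  have h : HX.neighborSet v = ∅ := Set.eq_empty_of_forall_notMem fun w hw =>
    hv (hEXX s(v, w) (hHX hw) v (Sym2.mem_mk_left v w))
  rw [subDeg, h, Set.ncard_empty]

/-- If two partial solutions have the same state `f` and one of them is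
extendable, then so is the other. -/
theorem stmt_6 [Finite V] (G : SimpleGraph V) (X B : Set V) (hBX : B ⊆ X)
    (EX : Set (Sym2 V)) (hEXG : EX ⊆ G.edgeSet)
    (hEXX : ∀ e ∈ EX, ∀ v ∈ e, v ∈ X)
    (hsep : ∀ u v : V, G.Adj u v → u ∈ X \ B → v ∈ X)
    (hcover : ∀ u v : V, G.Adj u v → u ∈ X → v ∈ X → u ∉ B → s(u, v) ∈ EX)
    (f : V → ℕ × ℕ) (H₁ H₂ : SimpleGraph V)
    (h₁ : IsPartialSolution B EX f H₁) (h₂ : IsPartialSolution B EX f H₂)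
    (hext : Extendable G B EX f H₁) :
    Extendable G B EX f H₂ := by
  obtain ⟨H, ⟨hHG, hH⟩, hHE, hf⟩ := hext
  obtain ⟨hE₂, hB₂, hc₂⟩ := h₂
  let K : SimpleGraph V :=
    { Adj := fun a b => (H.Adj a b ∧ s(a, b) ∉ EX) ∨ H₂.Adj a b
      symm := ⟨fun a b h => h.imp (fun h => ⟨h.1.symm, Sym2.eq_swap (a := a) ▸ h.2⟩) (·.symm)⟩
      loopless := ⟨fun a h => h.elim (fun h => h.1.ne rfl) (·.ne rfl)⟩ }
  have hK (a b : V) : K.Adj a b ↔ (H.Adj a b ∧ s(a, b) ∉ EX) ∨ H₂.Adj a b := Iff.rfl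
  have hmem {a b : V} (h : H₂.Adj a b) : s(a, b) ∈ EX := hE₂ h
  have hKE : K.edgeSet ∩ EX = H₂.edgeSet := by
    ext e
    induction e with
    | h a b =>
      simp only [Set.mem_inter_iff, SimpleGraph.mem_edgeSet, hK]
      have := @hmem a b
      tauto
  have hKG : K ≤ G := fun a b h => h.elim (fun h => hHG h.1) fun h => hEXG (hmem h)
  have hout (v : V) : {w | K.Adj v w ∧ s(v, w) ∉ EX} = {w | H.Adj v w ∧ s(v, w) ∉ EX} := by
    ext w
    simp only [Set.mem_ofPred_eq, hK]
    have := @hmem v w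
    tauto
  have hdeg {v : V} (h : subDeg H₁ v = subDeg H₂ v) : subDeg K v = subDeg H v := by
    rw [subDeg_eq_add_ncard hKE, subDeg_eq_add_ncard hHE, hout, h]
  have hdegB {v : V} (hv : v ∈ B) : subDeg K v = subDeg H v :=
    hdeg ((h₁.2.1 v hv).symm.trans (hB₂ v hv))
  have hdegX {v : V} (hv : v ∉ X) : subDeg K v = subDeg H v :=
    hdeg ((subDeg_eq_zero_of_notMem hEXX h₁.1 hv).trans
      (subDeg_eq_zero_of_notMem hEXX hE₂ hv).symm)
  have hdegI {v : V} (hv : v ∈ X) (hvB : v ∉ B) : subDeg K v = subDeg H₂ v := by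
    have h : {w | K.Adj v w ∧ s(v, w) ∉ EX} = ∅ := Set.eq_empty_of_forall_notMem fun w hw =>
      hw.2 (hcover v w (hKG hw.1) hv (hsep v w (hKG hw.1) ⟨hv, hvB⟩) hvB)
    rw [subDeg_eq_add_ncard hKE, h, Set.ncard_empty, Nat.add_zero]
  have hinner {a b : V} (hab : G.Adj a b) (ha : a ∈ X) (haB : a ∉ B) :
      subDeg K a ≠ subDeg K b := by
    have hb := hsep a b hab ⟨ha, haB⟩
    have he := hcover a b hab ha hb haB
    rw [hdegI ha haB]
    by_cases hbB : b ∈ B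
    · have h := (hc₂ b a (Sym2.eq_swap (a := a) ▸ he)).2.1 ⟨hbB, haB⟩
      rwa [hf b hbB, ← hdegB hbB] at h
    · rw [hdegI hb hbB]
      exact (hc₂ a b he).1 ⟨haB, hbB⟩
  have houter {v : V} (hv : ¬(v ∈ X ∧ v ∉ B)) : subDeg K v = subDeg H v := by
    by_cases hvX : v ∈ X
    · exact hdegB (not_not.1 fun h => hv ⟨hvX, h⟩)
    · exact hdegX hvX
  refine ⟨K, ⟨hKG, fun a b hab => ?_⟩, hKE, fun v hv => ?_⟩
  · by_cases ha : a ∈ X ∧ a ∉ B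
    · exact hinner hab ha.1 ha.2
    by_cases hb : b ∈ X ∧ b ∉ B
    · exact (hinner hab.symm hb.1 hb.2).symm
    rw [houter ha, houter hb]
    exact hH a b hab
  · rw [hdegB hv, ← hB₂ v hv, hf v hv]
end

section
/- Let G be a finite simple graph and let v, x, y be distinct vertices of G with vx ∈ E(G) and xy ∈ E(G), such that x has degree exactly 2 in G and y has degree exactly 1 in G. Then every proper weight function w : E(G) → {0,1} satisfies w(vx) = 1. -/
variable {V : Type*}

/-- The incidence set of a vertex is the image of its neighbor set. -/
theorem incidenceSet_eq_image_neighborSet (G : SimpleGraph V) (a : V) :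
    G.incidenceSet a = (fun b => s(a, b)) '' G.neighborSet a := by
  ext e
  constructor
  · rintro ⟨he, ha⟩
    obtain ⟨b, rfl⟩ := Sym2.mem_iff_exists.mp ha
    exact ⟨b, he, rfl⟩
  · rintro ⟨b, hb, rfl⟩
    exact ⟨hb, Sym2.mem_mk_left a b⟩

/-- The color of a vertex is the sum of weights of edges to its neighbors. -/
theorem vcColor_eq_sum_neighbors [Finite V] (G : SimpleGraph V) (w : Sym2 V → Fin 2) (a : V)
    (s : Finset V) (hs : G.neighborSet a = s) :
    vcColor G w a = ∑ b ∈ s, (w s(a, b) : ℕ) := by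
  classical
  have h : (G.incidenceSet a).toFinite.toFinset = s.image (fun b => s(a, b)) := by
    ext e
    simp [incidenceSet_eq_image_neighborSet, hs]
  rw [vcColor, h, Finset.sum_image]
  intro b _ c _ hbc
  exact Sym2.congr_right.mp hbc

/-- If `v x y` is a suspended path (`x` of degree 2, `y` of degree 1),
then every proper weighting gives weight 1 to the edge `vx`. -/
theorem stmt_7 [Finite V] (G : SimpleGraph V) (v x y : V)
    (hvy : v ≠ y) (hvx : G.Adj v x) (hxy : G.Adj x y)
    (hdx : subDeg G x = 2) (hdy : subDeg G y = 1)
    (w : Sym2 V → Fin 2) (hp : vcProper G w) :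
    w s(v, x) = 1 := by
  classical
  have hx : G.neighborSet x = (({v, y} : Finset V) : Set V) := by
    symm
    refine Set.eq_of_subset_of_ncard_le ?_ ?_ (Set.toFinite _)
    · intro z hz
      simp only [Finset.coe_insert, Finset.coe_singleton, Set.mem_insert_iff,
        Set.mem_singleton_iff] at hz
      rcases hz with rfl | rfl
      · exact hvx.symm
      · exact hxy
    · rw [Set.ncard_coe_finset, Finset.card_pair hvy]
      exact hdx.le
  have hy : G.neighborSet y = (({x} : Finset V) : Set V) := by
    symm
    refine Set.eq_of_subset_of_ncard_le ?_ ?_ (Set.toFinite _)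
    · intro z hz
      obtain rfl : z = x := by simpa using hz
      exact hxy.symm
    · rw [Set.ncard_coe_finset, Finset.card_singleton]
      exact hdy.le
  have h := hp x y hxy
  rw [vcColor_eq_sum_neighbors G w x _ hx, vcColor_eq_sum_neighbors G w y _ hy,
    Finset.sum_pair hvy, Finset.sum_singleton, Sym2.eq_swap (a := y),
    Sym2.eq_swap (a := x) (b := v)] at h
  lia
end

section
/- Let k ≥ 2 be an integer and let G be a finite simple graph containing distinct vertices a, u, v with edges au, av, uv ∈ E(G), such that the neighbors of u other than a and v are exactly the middle vertices of k − 1 suspended paths at u (so deg_G(u) = k + 1), and likewise the neighbors of v other than a and u are exactly the middle vertices of k − 1 suspended paths at v (so deg_G(v) = k + 1), with all these suspended-path vertices distinct from each other and from a, u, v. Then every proper weight function w : E(G) → {0,1} satisfies w(au) ≠ w(av), at least one of color_w(u) and color_w(v) equals k, and consequently color_w(a) ≠ k. -/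
variable {V : Type*}

/-- Index type naming the vertices of a type-A `k`-disallowing gadget:
the triangle `a, u, v` together with the middle (`xu`, `xv`) and end (`yu`, `yv`)
vertices of the `j`-th suspended path at `u` resp. `v`. -/
inductive Idx8 : Type where
  | a : Idx8
  | u : Idx8
  | v : Idx8
  | xu : ℕ → Idx8
  | yu : ℕ → Idx8
  | xv : ℕ → Idx8
  | yv : ℕ → Idx8

/-- Valid indices: the suspended-path indices range over `1, …, k - 1`. -/
def Idx8.Valid (k : ℕ) : Idx8 → Prop
  | .a => True
  | .u => True
  | .v => True
  | .xu j => 1 ≤ j ∧ j ≤ k - 1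
  | .yu j => 1 ≤ j ∧ j ≤ k - 1
  | .xv j => 1 ≤ j ∧ j ≤ k - 1
  | .yv j => 1 ≤ j ∧ j ≤ k - 1

theorem vcColor_eq_sum_of_neighborSet_eq [Finite V] {G : SimpleGraph V} (w : Sym2 V → Fin 2)
    {v : V} {S : Finset V} (h : G.neighborSet v = S) :
    vcColor G w v = ∑ x ∈ S, (w s(v, x) : ℕ) := by
  classical
  have hmem : ∀ x, x ∈ S ↔ G.Adj v x := fun x => by
    rw [← Finset.mem_coe, ← h, SimpleGraph.mem_neighborSet]
  have himage : (G.incidenceSet v).toFinite.toFinset = S.image fun x => s(v, x) := by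
    ext e
    induction e with | _ x y
    simp only [Set.Finite.mem_toFinset, SimpleGraph.mk'_mem_incidenceSet_iff, Finset.mem_image,
      hmem, Sym2.eq_iff]
    constructor
    · rintro ⟨hxy, rfl | rfl⟩
      · exact ⟨y, hxy, Or.inl ⟨rfl, rfl⟩⟩
      · exact ⟨x, hxy.symm, Or.inr ⟨rfl, rfl⟩⟩
    · rintro ⟨z, hz, ⟨rfl, rfl⟩ | ⟨rfl, rfl⟩⟩
      · exact ⟨hz, Or.inl rfl⟩
      · exact ⟨hz.symm, Or.inr rfl⟩
  rw [vcColor, himage, Finset.sum_image]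
  intro x _ y _ hxy
  exact Sym2.congr_right.mp hxy

/-- In a proper weighting, the first edge of a suspended path has weight `1`. -/
theorem vcProper.weight_suspendedPath [Finite V] {G : SimpleGraph V} {w : Sym2 V → Fin 2}
    (hp : vcProper G w) {u x y : V} (hux : G.Adj u x) (hxy : G.Adj x y) (huy : u ≠ y)
    (hx : subDeg G x = 2) (hy : subDeg G y = 1) : (w s(u, x) : ℕ) = 1 := by
  classical
  have hNx : G.neighborSet x = (({u, y} : Finset V) : Set V) := by
    refine (Set.eq_of_subset_of_ncard_le ?_ ?_ (Set.toFinite _)).symm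
    · intro z hz
      rcases (by simpa using hz : z = u ∨ z = y) with rfl | rfl
      exacts [hux.symm, hxy]
    · rw [Set.ncard_coe_finset, Finset.card_pair huy]
      exact hx.le
  have hNy : G.neighborSet y = (({x} : Finset V) : Set V) := by
    refine (Set.eq_of_subset_of_ncard_le ?_ ?_ (Set.toFinite _)).symm
    · intro z hz
      obtain rfl : z = x := by simpa using hz
      exact hxy.symm
    · rw [Set.ncard_coe_finset, Finset.card_singleton]
      exact hy.le
  have hne := hp x y hxy
  rw [vcColor_eq_sum_of_neighborSet_eq w hNx, vcColor_eq_sum_of_neighborSet_eq w hNy,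
    Finset.sum_pair huy, Finset.sum_singleton, Sym2.eq_swap (a := x) (b := u),
    Sym2.eq_swap (a := y) (b := x)] at hne
  have := (w s(u, x)).isLt
  omega

/-- If `u` has neighbors `a`, `v` and `n` further ones, joined to `u` by edges of weight `1`, then
its color is determined by the weights of `ua` and `uv`. -/
theorem vcColor_eq_add_of_neighborSet_eq [Finite V] {G : SimpleGraph V} {w : Sym2 V → Fin 2}
    {u a v : V} {n : ℕ} {x : ℕ → V} (hav : a ≠ v) (hx : Set.InjOn x (Set.Icc 1 n))
    (hxa : ∀ j ∈ Set.Icc 1 n, x j ≠ a) (hxv : ∀ j ∈ Set.Icc 1 n, x j ≠ v)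
    (hN : G.neighborSet u = {a, v} ∪ x '' Set.Icc 1 n)
    (hw : ∀ j ∈ Set.Icc 1 n, (w s(u, x j) : ℕ) = 1) :
    vcColor G w u = w s(u, a) + w s(u, v) + n := by
  classical
  have hS : G.neighborSet u =
      ((({a, v} : Finset V) ∪ (Finset.Icc 1 n).image x : Finset V) : Set V) := by
    rw [hN]
    push_cast
    rfl
  rw [vcColor_eq_sum_of_neighborSet_eq w hS, Finset.sum_union, Finset.sum_pair hav,
    Finset.sum_image (by simpa using hx),
    Finset.sum_congr rfl fun j hj => hw j (by simpa using hj)]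
  · simp
  · rw [Finset.disjoint_right]
    intro z hz
    obtain ⟨j, hj, rfl⟩ := Finset.mem_image.mp hz
    have hj' : j ∈ Set.Icc 1 n := by simpa using hj
    simp [hxa j hj', hxv j hj']

/-- In a type-A `k`-disallowing gadget on the triangle `a, u, v`,
every proper weighting `w` satisfies `w(au) ≠ w(av)`, one of `u, v` has color `k`,
and consequently `a` does not have color `k`. -/
theorem stmt_8 [Finite V] (G : SimpleGraph V) (k : ℕ) (hk : 2 ≤ k)
    (F : Idx8 → V) (hinj : Set.InjOn F {i | Idx8.Valid k i})
    (hau : G.Adj (F .a) (F .u)) (hav : G.Adj (F .a) (F .v)) (huv : G.Adj (F .u) (F .v))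
    (hnu : G.neighborSet (F .u) =
      {F .a, F .v} ∪ (fun j => F (.xu j)) '' Set.Icc 1 (k - 1))
    (hnv : G.neighborSet (F .v) =
      {F .a, F .u} ∪ (fun j => F (.xv j)) '' Set.Icc 1 (k - 1))
    (hpu : ∀ j ∈ Set.Icc 1 (k - 1),
      G.Adj (F .u) (F (.xu j)) ∧ G.Adj (F (.xu j)) (F (.yu j)) ∧
      subDeg G (F (.xu j)) = 2 ∧ subDeg G (F (.yu j)) = 1)
    (hpv : ∀ j ∈ Set.Icc 1 (k - 1),
      G.Adj (F .v) (F (.xv j)) ∧ G.Adj (F (.xv j)) (F (.yv j)) ∧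
      subDeg G (F (.xv j)) = 2 ∧ subDeg G (F (.yv j)) = 1)
    (w : Sym2 V → Fin 2) (hp : vcProper G w) :
    w s(F .a, F .u) ≠ w s(F .a, F .v) ∧
    (vcColor G w (F .u) = k ∨ vcColor G w (F .v) = k) ∧
    vcColor G w (F .a) ≠ k := by
  have hne : ∀ i j : Idx8, i.Valid k → j.Valid k → i ≠ j → F i ≠ F j :=
    fun i j hi hj hij h => hij (hinj hi hj h)
  have hu : vcColor G w (F .u) = w s(F .u, F .a) + w s(F .u, F .v) + (k - 1) := by
    refine vcColor_eq_add_of_neighborSet_eq hav.ne ?_ ?_ ?_ hnu ?_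
    · intro i hi j hj h
      exact Idx8.xu.inj (hinj (show Idx8.Valid k (.xu i) from hi)
        (show Idx8.Valid k (.xu j) from hj) h)
    · exact fun j hj => hne (.xu j) .a hj trivial nofun
    · exact fun j hj => hne (.xu j) .v hj trivial nofun
    · intro j hj
      obtain ⟨h₁, h₂, h₃, h₄⟩ := hpu j hj
      exact hp.weight_suspendedPath h₁ h₂ (hne .u (.yu j) trivial hj nofun) h₃ h₄
  have hv : vcColor G w (F .v) = w s(F .v, F .a) + w s(F .v, F .u) + (k - 1) := by
    refine vcColor_eq_add_of_neighborSet_eq hau.ne ?_ ?_ ?_ hnv ?_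
    · intro i hi j hj h
      exact Idx8.xv.inj (hinj (show Idx8.Valid k (.xv i) from hi)
        (show Idx8.Valid k (.xv j) from hj) h)
    · exact fun j hj => hne (.xv j) .a hj trivial nofun
    · exact fun j hj => hne (.xv j) .u hj trivial nofun
    · intro j hj
      obtain ⟨h₁, h₂, h₃, h₄⟩ := hpv j hj
      exact hp.weight_suspendedPath h₁ h₂ (hne .v (.yv j) trivial hj nofun) h₃ h₄
  rw [Sym2.eq_swap (a := F .u) (b := F .a)] at hu
  rw [Sym2.eq_swap (a := F .v) (b := F .a), Sym2.eq_swap (a := F .v) (b := F .u)] at hv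
  have hcuv := hp _ _ huv
  have hcau := hp _ _ hau
  have hcav := hp _ _ hav
  rw [ne_eq, Fin.ext_iff]
  have := (w s(F .a, F .u)).isLt
  have := (w s(F .a, F .v)).isLt
  have := (w s(F .u, F .v)).isLt
  omega
end

section
/- Let k, p, N be integers with 2 ≤ k < N and 2 ≤ p < N. Let H be a finite simple graph containing pairwise distinct vertices v, x₁, …, x_{N−k}, y₁, …, y_{N−p}, z, and for each i ∈ {1, …, N} vertices s_i, t_i, with the following structure: (i) H contains the path edges v x₁, x_i x_{i+1} for 1 ≤ i < N−k, x_{N−k} z, and v y₁, y_j y_{j+1} for 1 ≤ j < N−p, y_{N−p} z; (ii) for each i ∈ {1, …, N−k}, the neighbors of x_i other than its path neighbors are exactly the middle vertices of k + i − 1 suspended paths at x_i; (iii) for each j ∈ {1, …, N−p}, the neighbors of y_j other than its path neighbors are exactly the middle vertices of p + j − 1 suspended paths at y_j; (iv) for each i ∈ {1, …, N}, z s_i, z t_i, s_i t_i ∈ E(H), and the neighbors of s_i (respectively t_i) other than z and t_i (respectively s_i) are exactly the middle vertices of N + i − 1 suspended paths at s_i (respectively t_i); (v) deg_H(z) ≤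 3N; (vi) all the named vertices and all suspended-path vertices are pairwise distinct, and no vertex of this structure other than v and z has a neighbor in H outside the described structure. Then every proper weight function w : E(H) → {0,1} satisfies w(v x₁) = 0, w(v y₁) = 0, color_w(x₁) = k, and color_w(y₁) = p. -/
variable {V : Type*}

/-- Index type naming the vertices of two type-B disallowing gadgets at `v`
(disallowing colors `k` and `p`), sharing the hub `z` and its type-A gadgets:
the chains `x`/`y`, the triangles `z, sᵢ, tᵢ`, and the middle/end vertices of
all attached suspended paths. -/
inductive Idx10 : Type where
  | v : Idx10
  | z : Idx10
  | x : ℕ → Idx10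
  | y : ℕ → Idx10
  | s : ℕ → Idx10
  | t : ℕ → Idx10
  | xm : ℕ → ℕ → Idx10
  | xe : ℕ → ℕ → Idx10
  | ym : ℕ → ℕ → Idx10
  | ye : ℕ → ℕ → Idx10
  | sm : ℕ → ℕ → Idx10
  | se : ℕ → ℕ → Idx10
  | tm : ℕ → ℕ → Idx10
  | te : ℕ → ℕ → Idx10

/-- Valid index ranges for the structure with parameters `k, p, N`. -/
def Idx10.Valid (k p N : ℕ) : Idx10 → Prop
  | .v => True
  | .z => True
  | .x i => 1 ≤ i ∧ i ≤ N - k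
  | .y j => 1 ≤ j ∧ j ≤ N - p
  | .s i => 1 ≤ i ∧ i ≤ N
  | .t i => 1 ≤ i ∧ i ≤ N
  | .xm i j => (1 ≤ i ∧ i ≤ N - k) ∧ (1 ≤ j ∧ j ≤ k + i - 1)
  | .xe i j => (1 ≤ i ∧ i ≤ N - k) ∧ (1 ≤ j ∧ j ≤ k + i - 1)
  | .ym i j => (1 ≤ i ∧ i ≤ N - p) ∧ (1 ≤ j ∧ j ≤ p + i - 1)
  | .ye i j => (1 ≤ i ∧ i ≤ N - p) ∧ (1 ≤ j ∧ j ≤ p + i - 1)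
  | .sm i j => (1 ≤ i ∧ i ≤ N) ∧ (1 ≤ j ∧ j ≤ N + i - 1)
  | .se i j => (1 ≤ i ∧ i ≤ N) ∧ (1 ≤ j ∧ j ≤ N + i - 1)
  | .tm i j => (1 ≤ i ∧ i ≤ N) ∧ (1 ≤ j ∧ j ≤ N + i - 1)
  | .te i j => (1 ≤ i ∧ i ≤ N) ∧ (1 ≤ j ∧ j ≤ N + i - 1)

/-- The color of a vertex as a sum over its neighbors. -/
theorem vcColor_eq_sum [Finite V] (G : SimpleGraph V) (w : Sym2 V → Fin 2) (v : V) (S : Finset V)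
    (hS : ∀ u, u ∈ S ↔ G.Adj v u) : vcColor G w v = ∑ u ∈ S, (w s(v, u) : ℕ) := by
  classical
  have h : (G.incidenceSet v).toFinite.toFinset = S.image (fun u => s(v, u)) := by
    ext e
    simp only [Set.Finite.mem_toFinset, Finset.mem_image, hS]
    constructor
    · rintro ⟨he, hv⟩
      obtain ⟨u, rfl⟩ := Sym2.mem_iff_exists.1 hv
      exact ⟨u, he, rfl⟩
    · rintro ⟨u, hu, rfl⟩
      exact ⟨hu, Sym2.mem_mk_left v u⟩
  rw [vcColor, h, Finset.sum_image]
  intro a _ b _ hab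
  exact Sym2.congr_right.1 hab

/-- The first edge of a suspended path has weight `1` under a proper weighting. -/
theorem vcProper.weight_suspended [Finite V] {G : SimpleGraph V} {w : Sym2 V → Fin 2}
    (hp : vcProper G w) {u m e : V} (hum : G.Adj u m) (hme : G.Adj m e) (hue : u ≠ e)
    (hm : subDeg G m = 2) (he : subDeg G e = 1) : w s(u, m) = 1 := by
  classical
  have hSm : G.neighborSet m = {u, e} := by
    refine (Set.eq_of_subset_of_ncard_le ?_ ?_ (Set.toFinite _)).symm
    · rintro a (rfl | rfl)
      exacts [hum.symm, hme]
    · rw [Set.ncard_pair hue]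
      exact hm.le
  have hSe : G.neighborSet e = {m} := by
    refine (Set.eq_of_subset_of_ncard_le ?_ ?_ (Set.toFinite _)).symm
    · rintro a rfl
      exact hme.symm
    · rw [Set.ncard_singleton]
      exact he.le
  have hcm : vcColor G w m = (w s(m, u) : ℕ) + w s(m, e) := by
    rw [vcColor_eq_sum G w m {u, e}, Finset.sum_pair hue]
    intro a
    rw [← SimpleGraph.mem_neighborSet, hSm]
    simp
  have hce : vcColor G w e = (w s(e, m) : ℕ) := by
    rw [vcColor_eq_sum G w e {m}, Finset.sum_singleton]
    intro a
    rw [← SimpleGraph.mem_neighborSet, hSe]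
    simp
  have hne := hp _ _ hme
  rw [hcm, hce, Sym2.eq_swap (a := e), Sym2.eq_swap (a := m) (b := u)] at hne
  omega

/-- The color of a vertex with two distinguished neighbors `b`, `c`, all of whose other `n` edges
have weight `1`. -/
theorem vcColor_of_neighborSet_eq [Finite V] {G : SimpleGraph V} {w : Sym2 V → Fin 2}
    {a b c : V} {f : ℕ → V} {n : ℕ}
    (hn : G.neighborSet a = {b, c} ∪ f '' Set.Icc 1 n) (hbc : b ≠ c)
    (hf : Set.InjOn f (Set.Icc 1 n))
    (hb : ∀ j ∈ Set.Icc 1 n, f j ≠ b) (hc : ∀ j ∈ Set.Icc 1 n, f j ≠ c)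
    (hw : ∀ j ∈ Set.Icc 1 n, w s(a, f j) = 1) :
    vcColor G w a = w s(a, b) + w s(a, c) + n := by
  classical
  rw [vcColor_eq_sum G w a ({b, c} ∪ (Finset.Icc 1 n).image f), Finset.sum_union,
    Finset.sum_pair hbc, Finset.sum_image (by simpa using hf)]
  · congr 1
    rw [Finset.sum_congr rfl (g := fun _ => 1)]
    · simp
    · intro j hj
      rw [hw j (by simpa using hj)]
      rfl
  · rw [Finset.disjoint_right]
    intro x hx
    obtain ⟨j, hj, rfl⟩ := Finset.mem_image.1 hx
    have hj' : j ∈ Set.Icc 1 n := by simpa using hj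
    simp [hb j hj', hc j hj']
  · intro u
    rw [← SimpleGraph.mem_neighborSet, hn]
    simp [or_assoc]

/-- A hub of degree at most `3 * N` carrying `N` triangles that exclude the colors
`N + 1, …, 2 * N` gets color `N`, and all its edges outside the triangles have weight `0`. -/
theorem vcProper.hub [Finite V] {G : SimpleGraph V} {w : Sym2 V → Fin 2} (hp : vcProper G w)
    {z : V} {S T : ℕ → V} {N : ℕ} (hdz : subDeg G z ≤ 3 * N)
    (hS : Set.InjOn S (Set.Icc 1 N)) (hT : Set.InjOn T (Set.Icc 1 N))
    (hST : ∀ i ∈ Set.Icc 1 N, ∀ j ∈ Set.Icc 1 N, S i ≠ T j)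
    (htri : ∀ i ∈ Set.Icc 1 N, G.Adj z (S i) ∧ G.Adj z (T i) ∧ G.Adj (S i) (T i))
    (hcS : ∀ i ∈ Set.Icc 1 N,
      vcColor G w (S i) = w s(S i, z) + w s(S i, T i) + (N + i - 1))
    (hcT : ∀ i ∈ Set.Icc 1 N,
      vcColor G w (T i) = w s(T i, z) + w s(T i, S i) + (N + i - 1)) :
    vcColor G w z = N ∧ ∀ u, G.Adj z u → (∀ i ∈ Set.Icc 1 N, u ≠ S i ∧ u ≠ T i) →
      w s(z, u) = 0 := by
  classical
  have hsum : ∀ i ∈ Set.Icc 1 N, (w s(z, S i) : ℕ) + w s(z, T i) = 1 := by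
    intro i hi
    have h := hp _ _ (htri i hi).2.2
    rw [hcS i hi, hcT i hi, Sym2.eq_swap (a := T i) (b := S i), Sym2.eq_swap (a := T i),
      Sym2.eq_swap (a := S i) (b := z)] at h
    omega
  have hexcl : ∀ i ∈ Set.Icc 1 N, vcColor G w z ≠ N + i := by
    intro i hi
    have h := hsum i hi
    have h1 := hp _ _ (htri i hi).1
    have h2 := hp _ _ (htri i hi).2.1
    rw [hcS i hi, Sym2.eq_swap (a := S i) (b := z)] at h1
    rw [hcT i hi, Sym2.eq_swap (a := T i) (b := S i), Sym2.eq_swap (a := T i)] at h2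
    have hi1 := hi.1
    omega
  set A : Finset V := (G.neighborSet z).toFinite.toFinset with hA
  set P : Finset V := (Finset.Icc 1 N).image S ∪ (Finset.Icc 1 N).image T with hP
  have hdisj : Disjoint ((Finset.Icc 1 N).image S) ((Finset.Icc 1 N).image T) := by
    rw [Finset.disjoint_left]
    intro u hu hu'
    obtain ⟨i, hi, rfl⟩ := Finset.mem_image.1 hu
    obtain ⟨j, hj, hji⟩ := Finset.mem_image.1 hu'
    exact hST i (by simpa using hi) j (by simpa using hj) hji.symm
  have hS' : Set.InjOn S (Finset.Icc 1 N : Finset ℕ) := by simpa using hS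
  have hT' : Set.InjOn T (Finset.Icc 1 N : Finset ℕ) := by simpa using hT
  have hPA : P ⊆ A := by
    intro u hu
    rw [hA, Set.Finite.mem_toFinset]
    rcases Finset.mem_union.1 hu with hu | hu
    · obtain ⟨i, hi, rfl⟩ := Finset.mem_image.1 hu
      exact (htri i (by simpa using hi)).1
    · obtain ⟨i, hi, rfl⟩ := Finset.mem_image.1 hu
      exact (htri i (by simpa using hi)).2.1
  have hPcard : P.card = 2 * N := by
    rw [hP, Finset.card_union_of_disjoint hdisj, Finset.card_image_of_injOn hS',
      Finset.card_image_of_injOn hT', Nat.card_Icc]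
    omega
  have hAcard : A.card ≤ 3 * N := by
    rwa [hA, ← Set.ncard_eq_toFinset_card _ (Set.toFinite _)]
  have hPsum : ∑ u ∈ P, (w s(z, u) : ℕ) = N := by
    rw [hP, Finset.sum_union hdisj, Finset.sum_image hS', Finset.sum_image hT',
      ← Finset.sum_add_distrib, Finset.sum_congr rfl (g := fun _ => 1)]
    · simp
    · intro i hi
      exact hsum i (by simpa using hi)
  have hcz : vcColor G w z = ∑ u ∈ A \ P, (w s(z, u) : ℕ) + N := by
    rw [vcColor_eq_sum G w z A (by simp [hA]), ← Finset.sum_sdiff hPA, hPsum]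
  have hrest : ∑ u ∈ A \ P, (w s(z, u) : ℕ) ≤ N := by
    calc ∑ u ∈ A \ P, (w s(z, u) : ℕ) ≤ (A \ P).card * 1 :=
          Finset.sum_le_card_nsmul _ _ _ fun u _ => by omega
      _ ≤ N := by
          rw [Finset.card_sdiff_of_subset hPA]
          omega
  have hzero : ∑ u ∈ A \ P, (w s(z, u) : ℕ) = 0 := by
    by_contra h0
    exact hexcl _ ⟨Nat.one_le_iff_ne_zero.2 h0, hrest⟩ (by rw [hcz, add_comm])
  refine ⟨by rw [hcz, hzero, zero_add], fun u hu hne => ?_⟩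
  have hmem : u ∈ A \ P := by
    simp only [Finset.mem_sdiff, hA, hP, Set.Finite.mem_toFinset, Finset.mem_union,
      Finset.mem_image, Finset.mem_Icc]
    refine ⟨hu, ?_⟩
    rintro (⟨i, hi, rfl⟩ | ⟨i, hi, rfl⟩)
    exacts [(hne i hi).1 rfl, (hne i hi).2 rfl]
  have := Finset.sum_eq_zero_iff.1 hzero u hmem
  omega

/-- Along a chain `X 1, …, X M` from `v` to a vertex `z` of color `k + M`, in which `X i` has color
`k + i - 1` plus the weights of its two path edges and the last edge has weight `0`, the first edge
has weight `0` and the first vertex has color `k`. -/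
theorem vcProper.chain [Finite V] {G : SimpleGraph V} {w : Sym2 V → Fin 2} (hp : vcProper G w)
    {v z : V} {X : ℕ → V} {k M : ℕ} (hM : 1 ≤ M)
    (hadj : ∀ i ∈ Set.Icc 1 M, G.Adj (X i) (if i = M then z else X (i + 1)))
    (hcol : ∀ i ∈ Set.Icc 1 M, vcColor G w (X i) =
      w s(X i, if i = 1 then v else X (i - 1)) + w s(X i, if i = M then z else X (i + 1)) +
        (k + i - 1))
    (hz : vcColor G w z = k + M) (hwz : w s(X M, z) = 0) :
    w s(v, X 1) = 0 ∧ vcColor G w (X 1) = k := by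
  have key : ∀ i, i ≤ M → 1 ≤ i →
      w s(X i, if i = 1 then v else X (i - 1)) = 0 ∧ vcColor G w (X i) = k + i - 1 := by
    intro i hi
    induction hi using Nat.decreasingInduction with
    | self =>
      intro _
      have hc := hcol M ⟨hM, le_rfl⟩
      have ha := hp _ _ (hadj M ⟨hM, le_rfl⟩)
      rw [if_pos (c := M = M) rfl] at hc ha
      rw [hwz] at hc
      rw [hz] at ha
      simp only [Fin.val_zero] at hc
      omega
    | of_succ i hi ih =>
      intro h1
      obtain ⟨ihw, ihc⟩ := ih (by omega)
      have hmem : i ∈ Set.Icc 1 M := ⟨h1, hi.le⟩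
      have hc := hcol i hmem
      have ha := hp _ _ (hadj i hmem)
      rw [if_neg (c := i = M) (by omega)] at hc ha
      rw [if_neg (by omega), Nat.add_sub_cancel, Sym2.eq_swap] at ihw
      rw [ihw] at hc
      rw [ihc] at ha
      simp only [Fin.val_zero] at hc
      omega
  have h := key 1 hM le_rfl
  rw [if_pos rfl, Sym2.eq_swap] at h
  exact ⟨h.1, by simpa using h.2⟩

/-- In the two type-B disallowing gadgets at `v` (for colors `k` and `p`),
every proper weighting `w` gives weight `0` to the edges `v x₁` and `v y₁`, color `k`
to `x₁`, and color `p` to `y₁`. -/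
theorem stmt_10 [Finite V] (H : SimpleGraph V) (k p N : ℕ)
    (hk2 : 2 ≤ k) (hkN : k < N) (hp2 : 2 ≤ p) (hpN : p < N)
    (F : Idx10 → V) (hinj : Set.InjOn F {i | Idx10.Valid k p N i})
    -- (i), (ii): the chain from `v` through `x₁, …, x_{N-k}` to `z`; besides its two
    -- path neighbors, `xᵢ` is adjacent exactly to the middle vertices of `k + i - 1`
    -- suspended paths.
    (hnx : ∀ i ∈ Set.Icc 1 (N - k), H.neighborSet (F (.x i)) =
      {(if i = 1 then F .v else F (.x (i - 1))),
       (if i = N - k then F .z else F (.x (i + 1)))} ∪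
        (fun j => F (.xm i j)) '' Set.Icc 1 (k + i - 1))
    (hpx : ∀ i ∈ Set.Icc 1 (N - k), ∀ j ∈ Set.Icc 1 (k + i - 1),
      H.Adj (F (.x i)) (F (.xm i j)) ∧ H.Adj (F (.xm i j)) (F (.xe i j)) ∧
      subDeg H (F (.xm i j)) = 2 ∧ subDeg H (F (.xe i j)) = 1)
    -- (i), (iii): the chain from `v` through `y₁, …, y_{N-p}` to `z`.
    (hny : ∀ i ∈ Set.Icc 1 (N - p), H.neighborSet (F (.y i)) =
      {(if i = 1 then F .v else F (.y (i - 1))),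
       (if i = N - p then F .z else F (.y (i + 1)))} ∪
        (fun j => F (.ym i j)) '' Set.Icc 1 (p + i - 1))
    (hpy : ∀ i ∈ Set.Icc 1 (N - p), ∀ j ∈ Set.Icc 1 (p + i - 1),
      H.Adj (F (.y i)) (F (.ym i j)) ∧ H.Adj (F (.ym i j)) (F (.ye i j)) ∧
      subDeg H (F (.ym i j)) = 2 ∧ subDeg H (F (.ye i j)) = 1)
    -- (iv): the `N` type-A gadgets at `z`.
    (htri : ∀ i ∈ Set.Icc 1 N,
      H.Adj (F .z) (F (.s i)) ∧ H.Adj (F .z) (F (.t i)) ∧ H.Adj (F (.s i)) (F (.t i)))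
    (hns : ∀ i ∈ Set.Icc 1 N, H.neighborSet (F (.s i)) =
      {F .z, F (.t i)} ∪ (fun j => F (.sm i j)) '' Set.Icc 1 (N + i - 1))
    (hnt : ∀ i ∈ Set.Icc 1 N, H.neighborSet (F (.t i)) =
      {F .z, F (.s i)} ∪ (fun j => F (.tm i j)) '' Set.Icc 1 (N + i - 1))
    (hps : ∀ i ∈ Set.Icc 1 N, ∀ j ∈ Set.Icc 1 (N + i - 1),
      H.Adj (F (.s i)) (F (.sm i j)) ∧ H.Adj (F (.sm i j)) (F (.se i j)) ∧
      subDeg H (F (.sm i j)) = 2 ∧ subDeg H (F (.se i j)) = 1)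
    (hpt : ∀ i ∈ Set.Icc 1 N, ∀ j ∈ Set.Icc 1 (N + i - 1),
      H.Adj (F (.t i)) (F (.tm i j)) ∧ H.Adj (F (.tm i j)) (F (.te i j)) ∧
      subDeg H (F (.tm i j)) = 2 ∧ subDeg H (F (.te i j)) = 1)
    -- (v): the degree bound at the hub.
    (hdz : subDeg H (F .z) ≤ 3 * N)
    -- (vi): no vertex of the structure other than `v` and `z` has a neighbor outside it.
    (hclosed : ∀ a : Idx10, Idx10.Valid k p N a → a ≠ .v → a ≠ .z →
      ∀ u : V, H.Adj (F a) u → ∃ b : Idx10, Idx10.Valid k p N b ∧ u = F b)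
    (w : Sym2 V → Fin 2) (hp : vcProper H w) :
    w s(F .v, F (.x 1)) = 0 ∧ w s(F .v, F (.y 1)) = 0 ∧
    vcColor H w (F (.x 1)) = k ∧ vcColor H w (F (.y 1)) = p := by
  have hF : ∀ {a b : Idx10}, a.Valid k p N → b.Valid k p N → a ≠ b → F a ≠ F b :=
    fun ha hb hab => hinj.ne ha hb hab
  have hcS : ∀ i ∈ Set.Icc 1 N, vcColor H w (F (.s i)) =
      w s(F (.s i), F .z) + w s(F (.s i), F (.t i)) + (N + i - 1) := by
    intro i hi
    refine vcColor_of_neighborSet_eq (hns i hi) (hF trivial hi (by simp)) ?_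
      (fun j hj => hF ⟨hi, hj⟩ trivial (by simp)) (fun j hj => hF ⟨hi, hj⟩ hi (by simp)) ?_
    · intro j hj j' hj' h
      simpa using hinj (show Idx10.Valid k p N (.sm i j) from ⟨hi, hj⟩)
        (show Idx10.Valid k p N (.sm i j') from ⟨hi, hj'⟩) h
    · intro j hj
      obtain ⟨h1, h2, h3, h4⟩ := hps i hi j hj
      exact hp.weight_suspended h1 h2 (hF hi ⟨hi, hj⟩ (by simp)) h3 h4
  have hcT : ∀ i ∈ Set.Icc 1 N, vcColor H w (F (.t i)) =
      w s(F (.t i), F .z) + w s(F (.t i), F (.s i)) + (N + i - 1) := by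
    intro i hi
    refine vcColor_of_neighborSet_eq (hnt i hi) (hF trivial hi (by simp)) ?_
      (fun j hj => hF ⟨hi, hj⟩ trivial (by simp)) (fun j hj => hF ⟨hi, hj⟩ hi (by simp)) ?_
    · intro j hj j' hj' h
      simpa using hinj (show Idx10.Valid k p N (.tm i j) from ⟨hi, hj⟩)
        (show Idx10.Valid k p N (.tm i j') from ⟨hi, hj'⟩) h
    · intro j hj
      obtain ⟨h1, h2, h3, h4⟩ := hpt i hi j hj
      exact hp.weight_suspended h1 h2 (hF hi ⟨hi, hj⟩ (by simp)) h3 h4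
  have hcX : ∀ i ∈ Set.Icc 1 (N - k), vcColor H w (F (.x i)) =
      w s(F (.x i), if i = 1 then F .v else F (.x (i - 1))) +
        w s(F (.x i), if i = N - k then F .z else F (.x (i + 1))) + (k + i - 1) := by
    intro i hi
    have hi1 := hi.1
    have hi2 := hi.2
    refine vcColor_of_neighborSet_eq (hnx i hi) ?_ ?_ ?_ ?_ ?_
    · split_ifs <;> refine hF ?_ ?_ ?_ <;> simp [Idx10.Valid] <;> omega
    · intro j hj j' hj' h
      simpa using hinj (show Idx10.Valid k p N (.xm i j) from ⟨hi, hj⟩)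
        (show Idx10.Valid k p N (.xm i j') from ⟨hi, hj'⟩) h
    · intro j hj
      split_ifs <;> refine hF ⟨hi, hj⟩ ?_ ?_ <;> simp [Idx10.Valid] <;> omega
    · intro j hj
      split_ifs <;> refine hF ⟨hi, hj⟩ ?_ ?_ <;> simp [Idx10.Valid] <;> omega
    · intro j hj
      obtain ⟨h1, h2, h3, h4⟩ := hpx i hi j hj
      exact hp.weight_suspended h1 h2 (hF hi ⟨hi, hj⟩ (by simp)) h3 h4
  have hcY : ∀ i ∈ Set.Icc 1 (N - p), vcColor H w (F (.y i)) =
      w s(F (.y i), if i = 1 then F .v else F (.y (i - 1))) +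
        w s(F (.y i), if i = N - p then F .z else F (.y (i + 1))) + (p + i - 1) := by
    intro i hi
    have hi1 := hi.1
    have hi2 := hi.2
    refine vcColor_of_neighborSet_eq (hny i hi) ?_ ?_ ?_ ?_ ?_
    · split_ifs <;> refine hF ?_ ?_ ?_ <;> simp [Idx10.Valid] <;> omega
    · intro j hj j' hj' h
      simpa using hinj (show Idx10.Valid k p N (.ym i j) from ⟨hi, hj⟩)
        (show Idx10.Valid k p N (.ym i j') from ⟨hi, hj'⟩) h
    · intro j hj
      split_ifs <;> refine hF ⟨hi, hj⟩ ?_ ?_ <;> simp [Idx10.Valid] <;> omega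
    · intro j hj
      split_ifs <;> refine hF ⟨hi, hj⟩ ?_ ?_ <;> simp [Idx10.Valid] <;> omega
    · intro j hj
      obtain ⟨h1, h2, h3, h4⟩ := hpy i hi j hj
      exact hp.weight_suspended h1 h2 (hF hi ⟨hi, hj⟩ (by simp)) h3 h4
  have hadjX : ∀ i ∈ Set.Icc 1 (N - k),
      H.Adj (F (.x i)) (if i = N - k then F .z else F (.x (i + 1))) := by
    intro i hi
    rw [← SimpleGraph.mem_neighborSet, hnx i hi]
    simp
  have hadjY : ∀ i ∈ Set.Icc 1 (N - p),
      H.Adj (F (.y i)) (if i = N - p then F .z else F (.y (i + 1))) := by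
    intro i hi
    rw [← SimpleGraph.mem_neighborSet, hny i hi]
    simp
  obtain ⟨hz, hz0⟩ := hp.hub (S := fun i => F (.s i)) (T := fun i => F (.t i)) hdz
    (fun i hi j hj h => by
      simpa using hinj (show Idx10.Valid k p N (.s i) from hi)
        (show Idx10.Valid k p N (.s j) from hj) h)
    (fun i hi j hj h => by
      simpa using hinj (show Idx10.Valid k p N (.t i) from hi)
        (show Idx10.Valid k p N (.t j) from hj) h)
    (fun i hi j hj => hF hi hj (by simp)) htri hcS hcT
  have hMx : N - k ∈ Set.Icc 1 (N - k) := ⟨by omega, le_rfl⟩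
  have hMy : N - p ∈ Set.Icc 1 (N - p) := ⟨by omega, le_rfl⟩
  have hx0 : w s(F (.x (N - k)), F .z) = 0 := by
    rw [Sym2.eq_swap]
    refine hz0 _ (by simpa using (hadjX _ hMx).symm) fun i hi => ⟨?_, ?_⟩
    exacts [hF hMx hi (by simp), hF hMx hi (by simp)]
  have hy0 : w s(F (.y (N - p)), F .z) = 0 := by
    rw [Sym2.eq_swap]
    refine hz0 _ (by simpa using (hadjY _ hMy).symm) fun i hi => ⟨?_, ?_⟩
    exacts [hF hMy hi (by simp), hF hMy hi (by simp)]
  have hx := hp.chain (X := fun i => F (.x i)) hMx.1 hadjX hcX (by omega) hx0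
  have hy := hp.chain (X := fun i => F (.y i)) hMy.1 hadjY hcY (by omega) hy0
  exact ⟨hx.1, hy.1, hx.2, hy.2⟩
end
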